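/- Let Σ=(Γ=(V,E),σ) be a signed graph and write T_Σ = T_Σ(X,Y,Z) for its signed Tutte polynomial. Then for every edge e with σ(e)=+1: (i) if e is ordinary in Γ (neither a loop nor a bridge of Γ), then T_Σ = T_{Σ/e} + T_{Σ\e}; (ii) if e is a bridge of Γ and a circuit path edge of Σ, then T_Σ = T_{Σ/e} + (X−1)·T_{Σ\e}; (iii) if e is a bridge of Γ that is not a circuit path edge of Σ, then T_Σ = X·T_{Σ/e}; (iv) if e is a loop of Γ (necessarily positive in Σ), then T_Σ = Y·T_{Σ\e}. Moreover, if Σ consists of a single vertex carrying ℓ ≥ 1 negative loops, then T_Σ = 1 + (Z−1)·(1 + Y + ⋯ + Y^{ℓ−1}), and if Σ has no edges then T_Σ = 1. -/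

import Mathlib

attribute [local instance] Classical.propDecidable

noncomputable section SignedGraphs

/-- A signed graph: a multigraph with ordered pairs of endpoints (the order is
an artefact of the encoding) together with a sign `±1` on each edge. -/
structure SGraph (V : Type*) (E : Type*) where
  ends : E → V × V
  sign : E → ℤˣ

namespace SGraph

variable {V E : Type*}

/-- Endpoint of `e` on side `b`; a loop has both endpoints equal, but its two
half-edges are distinguished by the side `b`. -/
def endpt (Γ : SGraph V E) (e : E) (b : Bool) : V :=
  cond b (Γ.ends e).1 (Γ.ends e).2

/-- `e` is a loop of the underlying graph. -/
def IsLoop (Γ : SGraph V E) (e : E) : Prop := (Γ.ends e).1 = (Γ.ends e).2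

/-- Walks in a signed multigraph: a step traverses an edge `e` in direction `d`
(from the side-`d` endpoint to the other endpoint). -/
inductive Walk (Γ : SGraph V E) : V → V → Type _
  | nil (v : V) : Walk Γ v v
  | cons (e : E) (d : Bool) {w : V} (p : Walk Γ (Γ.endpt e (!d)) w) : Walk Γ (Γ.endpt e d) w

namespace Walk

variable {Γ : SGraph V E}

/-- The list of vertices visited by a walk (including the final one). -/
def verts : ∀ {u v : V}, Γ.Walk u v → List V
  | _, _, .nil x => [x]
  | _, _, .cons e d p => Γ.endpt e d :: p.verts

/-- The list of edges traversed by a walk. -/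
def edges : ∀ {u v : V}, Γ.Walk u v → List E
  | _, _, .nil _ => []
  | _, _, .cons e _ p => e :: p.edges

/-- The list of (edge, direction) steps of a walk. -/
def steps : ∀ {u v : V}, Γ.Walk u v → List (E × Bool)
  | _, _, .nil _ => []
  | _, _, .cons e d p => (e, d) :: p.steps

/-- The sources of the steps of a walk, i.e. all visited vertices except the last. -/
def srcs {u v : V} (W : Γ.Walk u v) : List V := W.verts.dropLast

/-- The sign of a walk: the product of the signs of its edges. -/
def sgn : ∀ {u v : V}, Γ.Walk u v → ℤˣ
  | _, _, .nil _ => 1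
  | _, _, .cons e _ p => Γ.sign e * p.sgn

/-- Concatenation of walks. -/
def append : ∀ {u v w : V}, Γ.Walk u v → Γ.Walk v w → Γ.Walk u w
  | _, _, _, .nil _, q => q
  | _, _, _, .cons e d p, q => .cons e d (p.append q)

/-- The sum `Σᵢ f(eᵢ)` of the values of `f` on the edges of the walk,
with multiplicity. -/
def edgeSum {G : Type*} [AddCommGroup G] (f : E → G) {u v : V} (W : Γ.Walk u v) : G :=
  (W.edges.map f).sum

/-- The sum `Σᵢ ω(vᵢ,eᵢ)·(Π_{j<i} σ(eⱼ))·f(eᵢ)` along a walk, where `ω(vᵢ,eᵢ)`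
is the value of `ω` on the half-edge by which the walk leaves `vᵢ`. -/
def tensionSum {G : Type*} [AddCommGroup G] (ω : E → Bool → ℤˣ) (f : E → G) :
    ∀ {u v : V}, Γ.Walk u v → G
  | _, _, .nil _ => 0
  | _, _, .cons e d p => ((ω e d : ℤ) • f e) + ((Γ.sign e : ℤ) • tensionSum ω f p)

/-- `Q` is the reverse of the walk `P`. -/
def IsReverseOf {u v : V} (Q : Γ.Walk v u) (P : Γ.Walk u v) : Prop :=
  Q.steps = P.steps.reverse.map fun s => (s.1, !s.2)

end Walk

/-- A closed walk is a cycle if it is nontrivial, visits no vertex twice and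
uses no edge twice. -/
def IsCycle (Γ : SGraph V E) {v : V} (W : Γ.Walk v v) : Prop :=
  W.edges ≠ [] ∧ W.srcs.Nodup ∧ W.edges.Nodup

/-- A balanced (positive) cycle. -/
def IsBalancedCycle (Γ : SGraph V E) {v : V} (W : Γ.Walk v v) : Prop :=
  Γ.IsCycle W ∧ W.sgn = 1

/-- An unbalanced (negative) cycle. -/
def IsUnbalancedCycle (Γ : SGraph V E) {v : V} (W : Γ.Walk v v) : Prop :=
  Γ.IsCycle W ∧ W.sgn = -1

/-- A nontrivial walk that is a simple path (all visited vertices distinct). -/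
def IsPathWalk (Γ : SGraph V E) {u v : V} (P : Γ.Walk u v) : Prop :=
  P.edges ≠ [] ∧ P.verts.Nodup

/-- A tight handcuff at `v`: two edge-disjoint unbalanced cycles sharing exactly
the vertex `v`. -/
def IsTightHandcuff (Γ : SGraph V E) {v : V} (C₁ C₂ : Γ.Walk v v) : Prop :=
  Γ.IsUnbalancedCycle C₁ ∧ Γ.IsUnbalancedCycle C₂ ∧
    (∀ x ∈ C₁.srcs, x ∈ C₂.srcs → x = v) ∧ ∀ e ∈ C₁.edges, e ∉ C₂.edges

/-- A loose handcuff: two vertex-disjoint unbalanced cycles `C₁` (at `u`) and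
`C₂` (at `w`) joined by a simple path `P` from `u` to `w` meeting the cycles
exactly in its endpoints. -/
def IsLooseHandcuff (Γ : SGraph V E) {u w : V} (C₁ : Γ.Walk u u) (P : Γ.Walk u w)
    (C₂ : Γ.Walk w w) : Prop :=
  Γ.IsUnbalancedCycle C₁ ∧ Γ.IsUnbalancedCycle C₂ ∧ Γ.IsPathWalk P ∧
    (∀ x ∈ C₁.srcs, x ∉ C₂.srcs) ∧
    (∀ x ∈ P.verts, x ∈ C₁.srcs → x = u) ∧
    (∀ x ∈ P.verts, x ∈ C₂.srcs → x = w) ∧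
    ∀ e ∈ P.edges, e ∉ C₁.edges ∧ e ∉ C₂.edges

/-- The canonical closed walks traversing a circuit of the signed graph:
a balanced cycle, a tight handcuff `C₁ * C₂`, or a loose handcuff
`C₁ * P * C₂ * P⁻¹` (the circuit path edges being used twice). -/
def IsBasicCircuitWalk (Γ : SGraph V E) {v : V} (W : Γ.Walk v v) : Prop :=
  Γ.IsBalancedCycle W ∨
    (∃ C₁ C₂ : Γ.Walk v v, Γ.IsTightHandcuff C₁ C₂ ∧ W = C₁.append C₂) ∨
    ∃ (w : V) (C₁ : Γ.Walk v v) (P : Γ.Walk v w) (C₂ : Γ.Walk w w) (Q : Γ.Walk w v),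
      Γ.IsLooseHandcuff C₁ P C₂ ∧ Q.IsReverseOf P ∧
        W = C₁.append (P.append (C₂.append Q))

/-- A circuit walk: a rotation of a basic circuit walk. -/
def IsCircuitWalk (Γ : SGraph V E) {v : V} (W : Γ.Walk v v) : Prop :=
  ∃ (u : V) (A : Γ.Walk u v) (B : Γ.Walk v u),
    W = B.append A ∧ Γ.IsBasicCircuitWalk (A.append B)

/-- `e` is a circuit path edge: it lies on the connecting path of an unbalanced
loose handcuff. -/
def IsCircuitPathEdge (Γ : SGraph V E) (e : E) : Prop :=
  ∃ (u w : V) (C₁ : Γ.Walk u u) (P : Γ.Walk u w) (C₂ : Γ.Walk w w),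
    Γ.IsLooseHandcuff C₁ P C₂ ∧ e ∈ P.edges

/-- Adjacency via an edge. -/
def Adj (Γ : SGraph V E) (a b : V) : Prop := ∃ e, Γ.ends e = (a, b) ∨ Γ.ends e = (b, a)

/-- The set of connected components. -/
def Components (Γ : SGraph V E) : Type _ := Quot Γ.Adj

/-- The connected component of a vertex. -/
def comp (Γ : SGraph V E) (v : V) : Γ.Components := Quot.mk _ v

/-- The number `k(Γ)` of connected components. -/
def kAll (Γ : SGraph V E) : ℕ := Nat.card Γ.Components

/-- A connected component is balanced if every cycle it contains is balanced. -/
def IsBalancedComponent (Γ : SGraph V E) (c : Γ.Components) : Prop :=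
  ∀ v : V, Γ.comp v = c → ∀ W : Γ.Walk v v, Γ.IsCycle W → W.sgn = 1

/-- The number `k_b(Σ)` of balanced connected components. -/
def kb (Γ : SGraph V E) : ℕ := Nat.card {c : Γ.Components // Γ.IsBalancedComponent c}

/-- The number `k_u(Σ)` of unbalanced connected components. -/
def ku (Γ : SGraph V E) : ℕ := Nat.card {c : Γ.Components // ¬ Γ.IsBalancedComponent c}

/-- A signed graph is balanced if all its cycles are balanced. -/
def Balanced (Γ : SGraph V E) : Prop :=
  ∀ (v : V) (W : Γ.Walk v v), Γ.IsCycle W → W.sgn = 1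

/-- A signed graph is connected if it has exactly one connected component. -/
def Connected (Γ : SGraph V E) : Prop := Γ.kAll = 1

/-- The spanning subgraph `Σ \ Aᶜ` with edge set `A`. -/
def restrict (Γ : SGraph V E) (A : Set E) : SGraph V A :=
  { ends := fun e => Γ.ends e, sign := fun e => Γ.sign e }

/-- The signed Tutte polynomial (as a function of `x`, `y`, `z`):
`T_Σ(X,Y,Z) = Σ_{A⊆E} (X−1)^{k(Σ\Aᶜ)−k(Σ)} (Y−1)^{|A|−|V|+k_b(Σ\Aᶜ)} (Z−1)^{k_u(Σ\Aᶜ)}`. -/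
def signedTutte {K : Type*} [CommRing K] (Γ : SGraph V E) (x y z : K) : K :=
  ∑ᶠ A : Finset E,
    (x - 1) ^ ((Γ.restrict (A : Set E)).kAll - Γ.kAll) *
      (y - 1) ^ ((A.card + (Γ.restrict (A : Set E)).kb) - Nat.card V) *
        (z - 1) ^ (Γ.restrict (A : Set E)).ku

/-- Deletion of an edge. -/
def deleteEdge (Γ : SGraph V E) (e : E) : SGraph V {e' : E // e' ≠ e} :=
  { ends := fun e' => Γ.ends e'.1, sign := fun e' => Γ.sign e'.1 }

/-- The relation identifying the two endpoints of `e`. -/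
def contractRel (Γ : SGraph V E) (e : E) (a b : V) : Prop := (a, b) = Γ.ends e

/-- Contraction of an edge: the two endpoints are identified and the edge is
deleted.  (For a loop this is just deletion, as the identification is trivial.) -/
def contract (Γ : SGraph V E) (e : E) : SGraph (Quot (Γ.contractRel e)) {e' : E // e' ≠ e} :=
  { ends := fun e' => (Quot.mk _ (Γ.ends e'.1).1, Quot.mk _ (Γ.ends e'.1).2),
    sign := fun e' => Γ.sign e'.1 }

/-- `e` is a bridge: its deletion increases the number of connected components. -/
def IsBridge (Γ : SGraph V E) (e : E) : Prop := Γ.kAll < (Γ.deleteEdge e).kAll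

/-- An orientation of the half-edges, compatible with the signature. -/
def IsCompatible (Γ : SGraph V E) (ω : E → Bool → ℤˣ) : Prop :=
  ∀ e, Γ.sign e = -(ω e true * ω e false)

/-- A `G`-flow: Kirchhoff's law holds at every vertex. -/
def IsFlow (Γ : SGraph V E) (ω : E → Bool → ℤˣ) {G : Type*} [AddCommGroup G]
    (f : E → G) : Prop :=
  ∀ v : V,
    (∑ᶠ e : E, ((if Γ.endpt e true = v then (ω e true : ℤ) • f e else 0) +
      (if Γ.endpt e false = v then (ω e false : ℤ) • f e else 0))) = 0

/-- A `G`-tension: the alternating sum along every circuit walk vanishes. -/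
def IsTension (Γ : SGraph V E) (ω : E → Bool → ℤˣ) {G : Type*} [AddCommGroup G]
    (f : E → G) : Prop :=
  ∀ (v : V) (W : Γ.Walk v v), Γ.IsCircuitWalk W → W.tensionSum ω f = 0

end SGraph

/-- The doubling homomorphism `x ↦ x + x = 2x` of an abelian group. -/
def doubleHom (G : Type*) [AddCommGroup G] : G →+ G :=
  AddMonoidHom.mk' (fun x => x + x) (fun a b => add_add_add_comm a b a b)

/-- The subgroup `2G = {2x : x ∈ G}`. -/
def twoG (G : Type*) [AddCommGroup G] : AddSubgroup G := (doubleHom G).range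

/-- The `2`-torsion subgroup `G₂ = {x ∈ G : 2x = 0}`. -/
def torsion2 (G : Type*) [AddCommGroup G] : AddSubgroup G := (doubleHom G).ker

namespace SGraph

variable {V E : Type*}

/-- A `G`-potential difference: a `G`-tension whose sum around every unbalanced
cycle lies in `2G`. -/
def IsPotentialDifference (Γ : SGraph V E) (ω : E → Bool → ℤˣ) {G : Type*} [AddCommGroup G]
    (f : E → G) : Prop :=
  Γ.IsTension ω f ∧
    ∀ (v : V) (W : Γ.Walk v v), Γ.IsUnbalancedCycle W → W.edgeSum f ∈ twoG G

end SGraph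

namespace SGraph

variable {V E : Type*}

/-- Proper coloring by elements of a set `X` with involution `ι`: adjacent
endpoints of a positive edge get different colors, and for a negative edge the
`ι`-image of one endpoint's color differs from the other endpoint's color. -/
def IsProperInvColoring (Γ : SGraph V E) {X : Type*} (ι : X → X) (f : V → X) : Prop :=
  ∀ e : E, (Γ.sign e = 1 → f ((Γ.ends e).1) ≠ f ((Γ.ends e).2)) ∧
    (Γ.sign e = -1 → ι (f ((Γ.ends e).1)) ≠ f ((Γ.ends e).2))

/-- A proper `G`-coloring: for every edge `e = uv`, `f(u) ≠ f(v)` if `e` is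
positive and `-f(u) ≠ f(v)` if `e` is negative, i.e. `σ(e)•f(u) ≠ f(v)`. -/
def IsProperColoring (Γ : SGraph V E) {G : Type*} [AddCommGroup G] (f : V → G) : Prop :=
  ∀ e : E, ((Γ.sign e : ℤ) • f ((Γ.ends e).1)) ≠ f ((Γ.ends e).2)

/-- Zaslavsky's proper `n`-coloring: colors in `{0, ±1, …, ±n}` with
`f(u) ≠ σ(e)·f(v)` for every edge `e = uv`. -/
def IsProperNColoring (Γ : SGraph V E) (n : ℕ) (f : V → ℤ) : Prop :=
  (∀ v, |f v| ≤ (n : ℤ)) ∧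
    ∀ e : E, f ((Γ.ends e).1) ≠ (Γ.sign e : ℤ) * f ((Γ.ends e).2)

/-- `T ⊆ E` is a spanning tree: the spanning subgraph `(V,T)` is connected and
contains no cycle. -/
def IsSpanningTree (Γ : SGraph V E) (T : Set E) : Prop :=
  (Γ.restrict T).Connected ∧
    ∀ (v : V) (W : (Γ.restrict T).Walk v v), ¬ (Γ.restrict T).IsCycle W

/-- A connected basis of a connected signed graph: a spanning tree if `Σ` is
balanced; otherwise a spanning tree plus one extra edge closing an unbalanced
cycle. -/
def IsConnectedBasis (Γ : SGraph V E) (B : Set E) : Prop :=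
  (Γ.Balanced ∧ Γ.IsSpanningTree B) ∨
    (¬ Γ.Balanced ∧ ∃ (T : Set E) (e : E), Γ.IsSpanningTree T ∧ e ∉ T ∧ B = insert e T ∧
      ∀ (v : V) (W : (Γ.restrict B).Walk v v), (Γ.restrict B).IsCycle W → W.sgn = -1)

/-- Switching at a vertex `v`: the sign of every non-loop edge incident with `v`
is negated; loops keep their sign. -/
def switchAt (Γ : SGraph V E) (v : V) : SGraph V E :=
  { ends := Γ.ends,
    sign := fun e => if ((Γ.ends e).1 = v ↔ (Γ.ends e).2 = v) then Γ.sign e else -Γ.sign e }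

/-- Switching at a set `S` of vertices (the composite of the switchings at the
vertices of `S`): the sign of an edge is negated iff exactly one of its
endpoints lies in `S`. -/
def switchSet (Γ : SGraph V E) (S : Set V) : SGraph V E :=
  { ends := Γ.ends,
    sign := fun e => if ((Γ.ends e).1 ∈ S ↔ (Γ.ends e).2 ∈ S) then Γ.sign e else -Γ.sign e }

/-- Isomorphism of signed graphs (as undirected signed multigraphs). -/
def Iso {V₁ E₁ V₂ E₂ : Type*} (Γ₁ : SGraph V₁ E₁) (Γ₂ : SGraph V₂ E₂) : Prop :=
  ∃ (φ : V₁ ≃ V₂) (ψ : E₁ ≃ E₂), ∀ e : E₁,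
    (Γ₂.ends (ψ e) = (φ (Γ₁.ends e).1, φ (Γ₁.ends e).2) ∨
      Γ₂.ends (ψ e) = (φ (Γ₁.ends e).2, φ (Γ₁.ends e).1)) ∧
    Γ₂.sign (ψ e) = Γ₁.sign e

/-- Switching equivalence: isomorphism after switching at a set of vertices. -/
def SwitchEquiv {V₁ E₁ V₂ E₂ : Type*} (Γ₁ : SGraph V₁ E₁) (Γ₂ : SGraph V₂ E₂) : Prop :=
  ∃ S : Set V₁, Iso (Γ₁.switchSet S) Γ₂

/-- Disjoint union of signed graphs. -/
def disjUnion {V₁ E₁ V₂ E₂ : Type*} (Γ₁ : SGraph V₁ E₁) (Γ₂ : SGraph V₂ E₂) :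
    SGraph (V₁ ⊕ V₂) (E₁ ⊕ E₂) where
  ends := fun e => match e with
    | .inl e => (Sum.inl (Γ₁.ends e).1, Sum.inl (Γ₁.ends e).2)
    | .inr e => (Sum.inr (Γ₂.ends e).1, Sum.inr (Γ₂.ends e).2)
  sign := fun e => match e with
    | .inl e => Γ₁.sign e
    | .inr e => Γ₂.sign e

/-- The difference operator `δ : G^V → G^E`,
`(δg)(e) = ω(v,e)·g(v) + ω(u,e)·g(u)` for `e = uv`. -/
def deltaHom (Γ : SGraph V E) (ω : E → Bool → ℤˣ) (G : Type*) [AddCommGroup G] :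
    (V → G) →+ (E → G) :=
  AddMonoidHom.mk'
    (fun g e => (ω e true : ℤ) • g ((Γ.ends e).1) + (ω e false : ℤ) • g ((Γ.ends e).2))
    (by
      intro a b
      funext e
      simp only [Pi.add_apply, smul_add]
      abel)

end SGraph

end SignedGraphs

section HelperWalks

namespace SGraph

variable {V E : Type*} {Γ : SGraph V E}

namespace Walk

theorem hp_start_mem {u v : V} (W : Γ.Walk u v) : u ∈ W.verts := by
  cases W <;> simp [verts]

theorem hp_end_mem {u v : V} (W : Γ.Walk u v) : v ∈ W.verts := by
  induction W with
  | nil x => simp [verts]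
  | cons e d p ih => simp [verts, ih]

theorem hp_verts_eq {u v : V} (W : Γ.Walk u v) : W.verts = W.srcs ++ [v] := by
  induction W with
  | nil x => simp [verts, srcs]
  | cons e d p ih =>
    have h : (Walk.cons e d p).srcs = Γ.endpt e d :: p.srcs := by
      unfold srcs
      simp only [verts]
      rw [List.dropLast_cons_of_ne_nil]
      intro h0
      have := p.hp_start_mem
      simp [h0] at this
    rw [h, verts, ih, List.cons_append]

theorem hp_srcs_nil (x : V) : (Walk.nil x : Γ.Walk x x).srcs = [] := rfl

theorem hp_srcs_cons (e : E) (d : Bool) {w : V} (p : Γ.Walk (Γ.endpt e (!d)) w) :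
    (Walk.cons e d p).srcs = Γ.endpt e d :: p.srcs := by
  have h := (Walk.cons e d p).hp_verts_eq
  rw [verts, p.hp_verts_eq, ← List.cons_append] at h
  exact (List.append_cancel_right h).symm

theorem hp_append_edges {u v w : V} (P : Γ.Walk u v) (Q : Γ.Walk v w) :
    (P.append Q).edges = P.edges ++ Q.edges := by
  induction P with
  | nil x => simp [append, edges]
  | cons e d p ih => simp [append, edges, ih]

theorem hp_append_sgn {u v w : V} (P : Γ.Walk u v) (Q : Γ.Walk v w) :
    (P.append Q).sgn = P.sgn * Q.sgn := by
  induction P with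
  | nil x => simp [append, sgn]
  | cons e d p ih => simp [append, sgn, ih, mul_assoc]

theorem hp_append_verts {u v w : V} (P : Γ.Walk u v) (Q : Γ.Walk v w) :
    (P.append Q).verts = P.srcs ++ Q.verts := by
  induction P with
  | nil x => simp [append, hp_srcs_nil]
  | cons e d p ih => simp [append, verts, ih, hp_srcs_cons]

theorem hp_append_srcs {u v w : V} (P : Γ.Walk u v) (Q : Γ.Walk v w) :
    (P.append Q).srcs = P.srcs ++ Q.srcs := by
  induction P with
  | nil x => simp [append, hp_srcs_nil]
  | cons e d p ih => simp [append, ih, hp_srcs_cons]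

theorem hp_split {u v : V} (W : Γ.Walk u v) {x : V} (hx : x ∈ W.verts) :
    ∃ (P : Γ.Walk u x) (Q : Γ.Walk x v), W = P.append Q := by
  induction W with
  | nil y =>
    simp only [verts, List.mem_singleton] at hx
    subst hx
    exact ⟨.nil _, .nil _, rfl⟩
  | cons e d p ih =>
    simp only [verts, List.mem_cons] at hx
    rcases hx with hx | hx
    · subst hx
      exact ⟨.nil _, .cons e d p, rfl⟩
    · obtain ⟨P, Q, h⟩ := ih hx
      exact ⟨.cons e d P, Q, by rw [append, h]⟩

theorem hp_step (Γ : SGraph V E) (e : E) (d : Bool) :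
    ∃ Q : Γ.Walk (Γ.endpt e (!d)) (Γ.endpt e d),
      Q.srcs = [Γ.endpt e (!d)] ∧ Q.edges = [e] ∧ Q.sgn = Γ.sign e := by
  cases d
  · exact ⟨.cons e true (.nil _), by simp [srcs, verts], by simp [edges], by simp [sgn]⟩
  · exact ⟨.cons e false (.nil _), by simp [srcs, verts], by simp [edges], by simp [sgn]⟩

theorem hp_reverse {u v : V} (W : Γ.Walk u v) :
    ∃ Q : Γ.Walk v u, Q.verts = W.verts.reverse ∧ Q.edges = W.edges.reverse ∧
      Q.sgn = W.sgn := by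
  induction W with
  | nil x => exact ⟨.nil x, by simp [verts], by simp [edges], by simp [sgn]⟩
  | cons e d p ih =>
    obtain ⟨Q, h1, h2, h3⟩ := ih
    obtain ⟨S, g1, g2, g3⟩ := hp_step Γ e d
    refine ⟨Q.append S, ?_, ?_, ?_⟩
    · rw [hp_append_verts, S.hp_verts_eq, g1, verts, List.reverse_cons, ← h1, Q.hp_verts_eq]
      simp
    · rw [hp_append_edges, h2, g2, edges, List.reverse_cons]
    · rw [hp_append_sgn, h3, g3, sgn, mul_comm]

theorem hp_edge_endpt {u v : V} (W : Γ.Walk u v) {e : E} (he : e ∈ W.edges) (b : Bool) :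
    Γ.endpt e b ∈ W.verts := by
  induction W with
  | nil x => simp [edges] at he
  | cons f d p ih =>
    simp only [edges, List.mem_cons] at he
    simp only [verts, List.mem_cons]
    rcases he with he | he
    · subst he
      by_cases h : b = d
      · subst h; exact Or.inl rfl
      · have : b = !d := by cases b <;> cases d <;> simp_all
        subst this
        exact Or.inr p.hp_start_mem
    · exact Or.inr (ih he)

theorem hp_srcs_sub {u v : V} (W : Γ.Walk u v) {x : V} (hx : x ∈ W.srcs) : x ∈ W.verts := by
  rw [hp_verts_eq]; exact List.mem_append_left _ hx

theorem hp_verts_closed {u : V} (W : Γ.Walk u u) (hW : W.edges ≠ []) {x : V}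
    (hx : x ∈ W.verts) : x ∈ W.srcs := by
  have hu : u ∈ W.srcs := by
    generalize h : u = v at W
    cases W with
    | nil => simp [edges] at hW
    | cons e d p => 
      rw [hp_srcs_cons]; simp
  rw [hp_verts_eq] at hx
  rcases List.mem_append.1 hx with h | h
  · exact h
  · rw [List.mem_singleton.1 h]; exact hu

theorem hp_closed_simple {u v : V} (W : Γ.Walk u v) (h : u = v) (hn : W.verts.Nodup) :
    W.edges = [] ∧ W.sgn = 1 := by
  cases W with
  | nil => simp [edges, sgn]
  | cons e d p =>
    subst h
    simp only [verts, List.nodup_cons] at hn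
    exact absurd p.hp_end_mem hn.1

theorem hp_simple_loop {u v : V} (W : Γ.Walk u v) (hn : W.verts.Nodup) {e : E}
    (he : e ∈ W.edges) (b : Bool) : Γ.endpt e b ≠ Γ.endpt e (!b) := by
  induction W with
  | nil => simp [edges] at he
  | cons f d p ih =>
    simp only [verts, List.nodup_cons] at hn
    simp only [edges, List.mem_cons] at he
    rcases he with he | he
    · subst he
      intro h
      apply hn.1
      have := p.hp_start_mem
      by_cases hb : b = d
      · subst hb; rwa [h]
      · have : b = !d := by cases b <;> cases d <;> simp_all
        subst this
        rw [Bool.not_not] at h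
        rw [← h]; assumption
    · exact ih hn.2 he

theorem hp_edges_nodup {u v : V} (W : Γ.Walk u v) (hn : W.verts.Nodup) : W.edges.Nodup := by
  induction W with
  | nil => simp [edges]
  | cons f d p ih =>
    simp only [verts, List.nodup_cons] at hn
    simp only [edges, List.nodup_cons]
    exact ⟨fun h => hn.1 (p.hp_edge_endpt h d), ih hn.2⟩

/-- A simple path between the endpoints of an edge it uses is that edge. -/
theorem hp_simple_edge {u v : V} (W : Γ.Walk u v) (hn : W.verts.Nodup) {e : E}
    (he : e ∈ W.edges) (b : Bool) (hu : Γ.endpt e b = u) (hv : Γ.endpt e (!b) = v) :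
    W.sgn = Γ.sign e := by
  cases W with
  | nil => simp [edges] at he
  | cons f d p =>
    simp only [verts, List.nodup_cons] at hn
    simp only [edges, List.mem_cons] at he
    rcases he with he | he
    · subst he
      by_cases hb : b = d
      · subst hb
        rw [sgn, (p.hp_closed_simple hv hn.2).2, mul_one]
      · have : d = !b := by cases b <;> cases d <;> simp_all
        subst this
        exact absurd (by rw [hv]; exact p.hp_end_mem) hn.1
    · exact absurd (by rw [← hu]; exact p.hp_edge_endpt he b) hn.1

theorem hp_reach {u v : V} (W : Γ.Walk u v) {x : V} (hx : x ∈ W.verts) :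
    ∃ P : Γ.Walk u x, P.edges ⊆ W.edges := by
  obtain ⟨P, Q, h⟩ := W.hp_split hx
  refine ⟨P, ?_⟩
  rw [h, hp_append_edges]
  exact List.subset_append_left _ _

/-- Either there is a negative cycle near a walk, or it can be replaced by a simple path
of the same sign. -/
theorem hp_extract {u v : V} (W : Γ.Walk u v) :
    (∃ (x : V) (P : Γ.Walk u x) (C : Γ.Walk x x), P.edges ⊆ W.edges ∧ C.edges ⊆ W.edges ∧
      Γ.IsUnbalancedCycle C) ∨
    ∃ P : Γ.Walk u v, P.verts.Nodup ∧ P.edges ⊆ W.edges ∧ P.sgn = W.sgn := by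
  induction W with
  | nil x => exact Or.inr ⟨.nil x, by simp [verts], by simp, rfl⟩
  | cons e d p ih =>
    rcases ih with ⟨x, P, C, h1, h2, h3⟩ | ⟨q, h1, h2, h3⟩
    · refine Or.inl ⟨x, .cons e d P, C, ?_, ?_, h3⟩
      · simp only [edges]; exact List.cons_subset_cons _ h1
      · simp only [edges]; exact List.subset_cons_of_subset _ h2
    · by_cases hm : Γ.endpt e d ∈ q.verts
      · obtain ⟨A, B, hAB⟩ := q.hp_split hm
        have hE : q.edges = A.edges ++ B.edges := by rw [hAB, hp_append_edges]
        have hAn : A.verts.Nodup := by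
          have h4 : (A.srcs ++ B.verts).Nodup := by rw [← hp_append_verts, ← hAB]; exact h1
          rw [hp_verts_eq]
          refine List.Nodup.sublist ?_ h4
          exact (List.Sublist.refl _).append (List.singleton_sublist.2 B.hp_start_mem)
        have hBn : B.verts.Nodup := by
          have h4 : (A.srcs ++ B.verts).Nodup := by rw [← hp_append_verts, ← hAB]; exact h1
          exact (List.nodup_append.1 h4).2.1
        have hAe : A.edges ⊆ p.edges := fun f hf => h2 (by rw [hE]; simp [hf])
        have hBe : B.edges ⊆ p.edges := fun f hf => h2 (by rw [hE]; simp [hf])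
        have hs : p.sgn = A.sgn * B.sgn := by rw [← h3, hAB, hp_append_sgn]
        by_cases hc : Γ.sign e * A.sgn = 1
        · refine Or.inr ⟨B, hBn, ?_, ?_⟩
          · simp only [edges]; exact List.subset_cons_of_subset _ hBe
          · rw [sgn, hs, ← mul_assoc, hc, one_mul]
        · have hc' : Γ.sign e * A.sgn = -1 := (Int.units_eq_one_or _).resolve_left hc
          refine Or.inl ⟨_, .nil _, .cons e d A, by simp [edges], ?_, ⟨?_, ?_, ?_⟩, ?_⟩
          · simp only [edges]; exact List.cons_subset_cons _ hAe
          · simp [edges]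
          · rw [hp_srcs_cons]
            rw [hp_verts_eq] at hAn
            exact (List.perm_append_singleton _ _).nodup_iff.1 hAn
          · simp only [edges, List.nodup_cons]
            refine ⟨fun hf => hc ?_, A.hp_edges_nodup hAn⟩
            rw [A.hp_simple_edge hAn hf (!d) rfl (by rw [Bool.not_not])]
            exact Int.units_mul_self _
          · rw [sgn]; exact hc'
      · refine Or.inr ⟨.cons e d q, ?_, ?_, ?_⟩
        · simp only [verts, List.nodup_cons]; exact ⟨hm, h1⟩
        · simp only [edges]; exact List.cons_subset_cons _ h2
        · rw [sgn, sgn, h3]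

theorem hp_neg_cycle {u : V} (W : Γ.Walk u u) (hW : W.sgn = -1) :
    ∃ (x : V) (P : Γ.Walk u x) (C : Γ.Walk x x), P.edges ⊆ W.edges ∧ C.edges ⊆ W.edges ∧
      Γ.IsUnbalancedCycle C := by
  rcases W.hp_extract with h | ⟨P, h1, h2, h3⟩
  · exact h
  · rw [(P.hp_closed_simple rfl h1).2, hW] at h3
    exact absurd h3 (by decide)

theorem hp_rotate {u x : V} (C : Γ.Walk u u) (hC : Γ.IsUnbalancedCycle C) (hx : x ∈ C.srcs) :
    ∃ C' : Γ.Walk x x, Γ.IsUnbalancedCycle C' ∧ C'.edges ⊆ C.edges := by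
  obtain ⟨P, Q, h⟩ := C.hp_split (C.hp_srcs_sub hx)
  obtain ⟨⟨h1, h2, h3⟩, h4⟩ := hC
  rw [h, hp_append_edges] at h1 h3
  rw [h, hp_append_srcs] at h2
  rw [h, hp_append_sgn] at h4
  refine ⟨Q.append P, ⟨⟨?_, ?_, ?_⟩, ?_⟩, ?_⟩
  · rw [hp_append_edges]; intro h0; apply h1; simp_all
  · rw [hp_append_srcs]; exact List.perm_append_comm.nodup_iff.1 h2
  · rw [hp_append_edges]; exact List.perm_append_comm.nodup_iff.1 h3
  · rw [hp_append_sgn, mul_comm]; exact h4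
  · rw [h, hp_append_edges, hp_append_edges]
    intro f hf
    simp only [List.mem_append] at hf ⊢
    tauto

theorem hp_lollipop {v u : V} (P : Γ.Walk v u) (S : Set E) (hS : ∀ f ∈ P.edges, f ∈ S)
    (C : Γ.Walk u u)
    (hC : Γ.IsUnbalancedCycle C) (hCS : ∀ f ∈ C.edges, f ∈ S) :
    ∃ (x : V) (Q : Γ.Walk v x) (D : Γ.Walk x x), Γ.IsUnbalancedCycle D ∧
      (∀ f ∈ Q.edges, f ∈ S) ∧ (∀ f ∈ D.edges, f ∈ S) ∧ Q.verts.Nodup ∧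
      ∀ y ∈ Q.verts, y ∈ D.srcs → y = x := by
  induction P with
  | nil x => exact ⟨x, .nil x, C, hC, by simp [edges], hCS, by simp [verts], by simp [verts]⟩
  | cons e d p ih =>
    obtain ⟨x, Q, D, h1, h2, h3, h4, h5⟩ :=
      ih (fun f hf => hS f (by simp [edges, hf])) C hC hCS
    by_cases hx : Γ.endpt e d ∈ D.srcs
    · obtain ⟨D', g1, g2⟩ := D.hp_rotate h1 hx
      exact ⟨_, .nil _, D', g1, by simp [edges], fun f hf => h3 f (g2 hf), by simp [verts],
        by simp [verts]⟩
    · by_cases hq : Γ.endpt e d ∈ Q.verts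
      · obtain ⟨A, B, h⟩ := Q.hp_split hq
        rw [h, hp_append_verts] at h4 h5
        rw [h, hp_append_edges] at h2
        exact ⟨x, B, D, h1, fun f hf => h2 f (List.mem_append_right _ hf), h3,
          (List.nodup_append.1 h4).2.1, fun y hy => h5 y (List.mem_append_right _ hy)⟩
      · refine ⟨x, .cons e d Q, D, h1, ?_, h3, ?_, ?_⟩
        · intro f hf
          simp only [edges, List.mem_cons] at hf
          rcases hf with hf | hf
          · exact hS f (by simp [edges, hf])
          · exact h2 f hf
        · simp only [verts, List.nodup_cons]; exact ⟨hq, h4⟩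
        · intro y hy hD
          simp only [verts, List.mem_cons] at hy
          rcases hy with hy | hy
          · exact absurd (hy ▸ hD) hx
          · exact h5 y hy hD

end Walk

open Walk in
/-- Two negative closed walks on the two sides of a separating edge give a loose handcuff. -/
theorem hp_handcuff (Γ : SGraph V E) (e : E)
    (hsep : ∀ W : Γ.Walk (Γ.endpt e true) (Γ.endpt e false), e ∈ W.edges)
    (W₁ : Γ.Walk (Γ.endpt e true) (Γ.endpt e true)) (h₁ : W₁.sgn = -1) (he₁ : e ∉ W₁.edges)
    (W₂ : Γ.Walk (Γ.endpt e false) (Γ.endpt e false)) (h₂ : W₂.sgn = -1) (he₂ : e ∉ W₂.edges) :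
    Γ.IsCircuitPathEdge e := by
  obtain ⟨x₁, P₁, C₁, a1, a2, a3⟩ := W₁.hp_neg_cycle h₁
  obtain ⟨x₂, P₂, C₂, b1, b2, b3⟩ := W₂.hp_neg_cycle h₂
  obtain ⟨u, Q₁, D₁, c1, c2, c3, c4, c5⟩ := P₁.hp_lollipop {f | f ≠ e}
    (fun f hf h => he₁ (a1 (h ▸ hf))) C₁ a3 (fun f hf h => he₁ (a2 (h ▸ hf)))
  obtain ⟨w, Q₂, D₂, d1, d2, d3, d4, d5⟩ := P₂.hp_lollipop {f | f ≠ e}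
    (fun f hf h => he₂ (b1 (h ▸ hf))) C₂ b3 (fun f hf h => he₂ (b2 (h ▸ hf)))
  -- separation
  have key : ∀ y, (∃ A : Γ.Walk (Γ.endpt e true) y, e ∉ A.edges) →
      (∃ B : Γ.Walk (Γ.endpt e false) y, e ∉ B.edges) → False := by
    rintro y ⟨A, hA⟩ ⟨B, hB⟩
    obtain ⟨B', _, hB', _⟩ := B.hp_reverse
    have := hsep (A.append B')
    rw [hp_append_edges, hB'] at this
    simp [hA, hB] at this
  have sQ1 : ∀ y ∈ Q₁.verts, ∃ A : Γ.Walk (Γ.endpt e true) y, e ∉ A.edges := by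
    intro y hy
    obtain ⟨A, hA⟩ := Q₁.hp_reach hy
    exact ⟨A, fun h => c2 e (hA h) rfl⟩
  have sQ2 : ∀ y ∈ Q₂.verts, ∃ A : Γ.Walk (Γ.endpt e false) y, e ∉ A.edges := by
    intro y hy
    obtain ⟨A, hA⟩ := Q₂.hp_reach hy
    exact ⟨A, fun h => d2 e (hA h) rfl⟩
  have sD1 : ∀ y ∈ D₁.srcs, ∃ A : Γ.Walk (Γ.endpt e true) y, e ∉ A.edges := by
    intro y hy
    obtain ⟨A, hA⟩ := D₁.hp_reach (D₁.hp_srcs_sub hy)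
    refine ⟨Q₁.append A, fun h => ?_⟩
    rw [hp_append_edges] at h
    rcases List.mem_append.1 h with h | h
    · exact c2 e h rfl
    · exact c3 e (hA h) rfl
  have sD2 : ∀ y ∈ D₂.srcs, ∃ A : Γ.Walk (Γ.endpt e false) y, e ∉ A.edges := by
    intro y hy
    obtain ⟨A, hA⟩ := D₂.hp_reach (D₂.hp_srcs_sub hy)
    refine ⟨Q₂.append A, fun h => ?_⟩
    rw [hp_append_edges] at h
    rcases List.mem_append.1 h with h | h
    · exact d2 e h rfl
    · exact d3 e (hA h) rfl
  obtain ⟨R, r1, r2, _⟩ := Q₁.hp_reverse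
  let P : Γ.Walk u w := R.append (.cons e true Q₂)
  have hPv : P.verts = Q₁.verts.reverse ++ Q₂.verts := by
    simp only [P]
    rw [hp_append_verts, verts, ← r1, R.hp_verts_eq]
    simp
  have hPe : P.edges = R.edges ++ e :: Q₂.edges := by
    simp only [P]
    rw [hp_append_edges, edges]
  have hPn : P.verts.Nodup := by
    rw [hPv, List.nodup_append]
    refine ⟨List.nodup_reverse.2 c4, d4, ?_⟩
    intro y hy z hz hyz
    subst hyz
    exact key y (sQ1 y (List.mem_reverse.1 hy)) (sQ2 y hz)
  have hp1 : ∀ y ∈ P.verts, y ∈ D₁.srcs → y = u := by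
    intro y hy hD
    rw [hPv, List.mem_append, List.mem_reverse] at hy
    rcases hy with hy | hy
    · exact c5 y hy hD
    · exact (key y (sD1 y hD) (sQ2 y hy)).elim
  have hp2 : ∀ y ∈ P.verts, y ∈ D₂.srcs → y = w := by
    intro y hy hD
    rw [hPv, List.mem_append, List.mem_reverse] at hy
    rcases hy with hy | hy
    · exact (key y (sQ1 y hy) (sD2 y hD)).elim
    · exact d5 y hy hD
  refine ⟨u, w, D₁, P, D₂, ⟨c1, d1, ⟨?_, hPn⟩, ?_, hp1, hp2, ?_⟩, ?_⟩
  · rw [hPe]; simp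
  · intro y hy hy'
    exact key y (sD1 y hy) (sD2 y hy')
  · intro f hf
    have hl := P.hp_simple_loop hPn hf true
    constructor
    · intro hD
      have q : ∀ b, Γ.endpt f b = u := fun b => hp1 _ (P.hp_edge_endpt hf b)
        (D₁.hp_verts_closed c1.1.1 (D₁.hp_edge_endpt hD b))
      exact hl ((q _).trans (q _).symm)
    · intro hD
      have q : ∀ b, Γ.endpt f b = w := fun b => hp2 _ (P.hp_edge_endpt hf b)
        (D₂.hp_verts_closed d1.1.1 (D₂.hp_edge_endpt hD b))
      exact hl ((q _).trans (q _).symm)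
  · rw [hPe]; simp

end SGraph

end HelperWalks

noncomputable section HelperCount

namespace SGraph

/-- The equivalence relation obtained by joining the classes of `a` and `b`. -/
def hpAdd {U : Type*} (S : Setoid U) (a b : U) : Setoid U where
  r x y := S x y ∨ (S x a ∧ S b y) ∨ (S x b ∧ S a y)
  iseqv := by
    refine ⟨fun x => Or.inl (S.refl x), ?_, ?_⟩
    · rintro x y (h | ⟨h1, h2⟩ | ⟨h1, h2⟩)
      · exact Or.inl (S.symm h)
      · exact Or.inr (Or.inr ⟨S.symm h2, S.symm h1⟩)
      · exact Or.inr (Or.inl ⟨S.symm h2, S.symm h1⟩)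
    · rintro x y z (h | ⟨h1, h2⟩ | ⟨h1, h2⟩) (g | ⟨g1, g2⟩ | ⟨g1, g2⟩)
      · exact Or.inl (S.trans h g)
      · exact Or.inr (Or.inl ⟨S.trans h g1, g2⟩)
      · exact Or.inr (Or.inr ⟨S.trans h g1, g2⟩)
      · exact Or.inr (Or.inl ⟨h1, S.trans h2 g⟩)
      · exact Or.inr (Or.inl ⟨h1, g2⟩)
      · exact Or.inl (S.trans h1 g2)
      · exact Or.inr (Or.inr ⟨h1, S.trans h2 g⟩)
      · exact Or.inl (S.trans h1 g2)
      · exact Or.inr (Or.inr ⟨h1, g2⟩)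

theorem hpAdd_iff {U : Type*} (S : Setoid U) (a b x y : U) :
    hpAdd S a b x y ↔ (S x y ∨ (S x a ∧ S b y) ∨ (S x b ∧ S a y)) := Iff.rfl

theorem hpAdd_eq {U : Type*} (S : Setoid U) (a b : U) (h : S a b) : hpAdd S a b = S := by
  ext x y
  rw [hpAdd_iff]
  constructor
  · rintro (h1 | ⟨h1, h2⟩ | ⟨h1, h2⟩)
    · exact h1
    · exact S.trans h1 (S.trans h h2)
    · exact S.trans h1 (S.trans (S.symm h) h2)
  · exact Or.inl

theorem hpAdd_card {U : Type*} [Finite U] (S : Setoid U) (a b : U) (h : ¬ S a b) :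
    Nat.card (Quotient (hpAdd S a b)) + 1 = Nat.card (Quotient S) := by
  have hq : ∀ x y : U, S x y → hpAdd S a b x y := fun x y hxy => Or.inl hxy
  let f : {q : Quotient S // q ≠ Quotient.mk S b} → Quotient (hpAdd S a b) :=
    fun q => Quotient.map' (s₁ := S) (s₂ := hpAdd S a b) id hq q.1
  have hf : Function.Bijective f := by
    constructor
    · rintro ⟨p, hp⟩ ⟨q, hq'⟩ hpq
      induction p using Quotient.inductionOn with | _ x
      induction q using Quotient.inductionOn with | _ y
      have hx : ¬ S x b := fun h0 => hp (Quotient.sound h0)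
      have hy : ¬ S y b := fun h0 => hq' (Quotient.sound h0)
      have h1 : hpAdd S a b x y := Quotient.exact hpq
      apply Subtype.ext
      rcases h1 with h1 | ⟨h1, h2⟩ | ⟨h1, h2⟩
      · exact Quotient.sound h1
      · exact absurd (S.symm h2) hy
      · exact absurd h1 hx
    · intro q
      induction q using Quotient.inductionOn with | _ y
      by_cases hy : S y b
      · refine ⟨⟨Quotient.mk S a, fun h0 => h (Quotient.exact h0)⟩, ?_⟩
        exact Quotient.sound (s := hpAdd S a b)
          (Or.inr (Or.inl ⟨S.refl a, S.symm hy⟩))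
      · exact ⟨⟨Quotient.mk S y, fun h0 => hy (Quotient.exact h0)⟩, rfl⟩
  rw [← Nat.card_congr (Equiv.ofBijective f hf)]
  have := Fintype.ofFinite (Quotient S)
  have : Nonempty (Quotient S) := ⟨Quotient.mk S b⟩
  have h1 : 0 < Fintype.card (Quotient S) := Fintype.card_pos
  rw [Nat.card_eq_fintype_card, Nat.card_eq_fintype_card]
  have h2 : Fintype.card {q : Quotient S // q ≠ Quotient.mk S b} =
      Fintype.card (Quotient S) - 1 := Set.card_ne_eq _
  omega

/-- General comparison of quotients. -/
theorem hp_card_quot {U U' : Type*} (r : U → U → Prop) (r' : U' → U' → Prop) (f : U → U')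
    (hf : Function.Surjective f)
    (h1 : ∀ x y, f x = f y → Relation.EqvGen r x y)
    (h2 : ∀ x' y', r' x' y' → ∃ x y, f x = x' ∧ f y = y' ∧ Relation.EqvGen r x y)
    (h3 : ∀ x y, r x y → Relation.EqvGen r' (f x) (f y)) :
    Nat.card (Quot r') = Nat.card (Quot r) := by
  have key : ∀ p q, Relation.EqvGen r' p q → ∀ x y, f x = p → f y = q → Relation.EqvGen r x y := by
    intro p q hpq
    induction hpq with
    | rel p q h =>
      intro x y hx hy
      obtain ⟨x0, y0, e1, e2, e3⟩ := h2 p q h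
      exact ((h1 x x0 (hx.trans e1.symm)).trans _ _ _ e3).trans _ _ _ (h1 y0 y (e2.trans hy.symm))
    | refl p =>
      intro x y hx hy
      exact h1 x y (hx.trans hy.symm)
    | symm p q _ ih =>
      intro x y hx hy
      exact (ih y x hy hx).symm
    | trans p q s _ _ ih1 ih2 =>
      intro x y hx hy
      obtain ⟨z, hz⟩ := hf q
      exact (ih1 x z hx hz).trans _ _ _ (ih2 z y hz hy)
  let g : Quot r → Quot r' := Quot.lift (fun x => Quot.mk r' (f x))
    (fun x y hxy => Quot.eqvGen_sound (h3 x y hxy))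
  refine (Nat.card_congr (Equiv.ofBijective g ⟨?_, ?_⟩)).symm
  · intro p q
    induction p using Quot.inductionOn with | _ x
    induction q using Quot.inductionOn with | _ y
    intro h
    exact Quot.eqvGen_sound (key _ _ (Quot.eqvGen_exact h) x y rfl rfl)
  · intro q
    induction q using Quot.inductionOn with | _ y
    obtain ⟨x, hx⟩ := hf y
    exact ⟨Quot.mk r x, by simp only [g, hx]⟩

variable {V E : Type*}

/-- Adjacency in the signed double cover. -/
def hpDAdj (Γ : SGraph V E) (p q : V × ℤˣ) : Prop :=
  ∃ e, (Γ.ends e = (p.1, q.1) ∨ Γ.ends e = (q.1, p.1)) ∧ q.2 = p.2 * Γ.sign e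

/-- The number of components of the double cover. -/
def hpkD (Γ : SGraph V E) : ℕ := Nat.card (Quot Γ.hpDAdj)

def hpConn (Γ : SGraph V E) : Setoid V := Relation.EqvGen.setoid Γ.Adj

def hpCov (Γ : SGraph V E) : Setoid (V × ℤˣ) := Relation.EqvGen.setoid Γ.hpDAdj

theorem hpConn_iff (Γ : SGraph V E) (x y : V) : Γ.hpConn x y ↔ Relation.EqvGen Γ.Adj x y := Iff.rfl

theorem hpCov_iff (Γ : SGraph V E) (x y : V × ℤˣ) :
    Γ.hpCov x y ↔ Relation.EqvGen Γ.hpDAdj x y := Iff.rfl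

theorem hp_kAll_eq (Γ : SGraph V E) : Γ.kAll = Nat.card (Quotient Γ.hpConn) := by
  refine hp_card_quot _ _ id Function.surjective_id ?_ ?_ ?_
  · rintro x y rfl; exact Relation.EqvGen.refl _
  · intro x y h; exact ⟨x, y, rfl, rfl, Relation.EqvGen.rel _ _ (Relation.EqvGen.rel _ _ h)⟩
  · intro x y h; exact h

theorem hp_kD_eq (Γ : SGraph V E) : Γ.hpkD = Nat.card (Quotient Γ.hpCov) := by
  refine hp_card_quot _ _ id Function.surjective_id ?_ ?_ ?_
  · rintro x y rfl; exact Relation.EqvGen.refl _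
  · intro x y h; exact ⟨x, y, rfl, rfl, Relation.EqvGen.rel _ _ (Relation.EqvGen.rel _ _ h)⟩
  · intro x y h; exact h

theorem hp_exists_step (Γ : SGraph V E) (e : E) (a b : V)
    (h : Γ.ends e = (a, b) ∨ Γ.ends e = (b, a)) :
    ∃ W : Γ.Walk a b, W.edges = [e] ∧ W.sgn = Γ.sign e := by
  rcases h with h | h
  · have h1 : Γ.endpt e true = a := by simp [endpt, h]
    have h2 : Γ.endpt e (!true) = b := by simp [endpt, h]
    subst h1 h2
    exact ⟨.cons e true (.nil _), by simp [Walk.edges], by simp [Walk.sgn]⟩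
  · have h1 : Γ.endpt e false = a := by simp [endpt, h]
    have h2 : Γ.endpt e (!false) = b := by simp [endpt, h]
    subst h1 h2
    exact ⟨.cons e false (.nil _), by simp [Walk.edges], by simp [Walk.sgn]⟩

theorem hp_cov_of_walk (Γ : SGraph V E) {u v : V} (W : Γ.Walk u v) (s : ℤˣ) :
    Γ.hpCov (u, s) (v, s * W.sgn) := by
  induction W generalizing s with
  | nil x => rw [Walk.sgn, mul_one]
  | cons e d p ih =>
    have h2 := ih (s * Γ.sign e)
    rw [mul_assoc] at h2
    have h1 : Γ.hpCov (Γ.endpt e d, s) (Γ.endpt e (!d), s * Γ.sign e) := by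
      refine Relation.EqvGen.rel _ _ ⟨e, ?_, rfl⟩
      cases d <;> simp [endpt]
    exact Setoid.trans' _ h1 h2

theorem hp_walk_of_cov (Γ : SGraph V E) {p q : V × ℤˣ} (h : Γ.hpCov p q) :
    ∃ W : Γ.Walk p.1 q.1, q.2 = p.2 * W.sgn := by
  rw [hpCov_iff] at h
  induction h with
  | rel p q h =>
    obtain ⟨e, h1, h2⟩ := h
    obtain ⟨W, _, hW⟩ := hp_exists_step Γ e _ _ h1
    exact ⟨W, by rw [hW]; exact h2⟩
  | refl p => exact ⟨.nil _, by simp [Walk.sgn]⟩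
  | symm p q _ ih =>
    obtain ⟨W, hW⟩ := ih
    obtain ⟨W', _, _, h⟩ := W.hp_reverse
    refine ⟨W', ?_⟩
    rw [h, hW, mul_assoc, Int.units_mul_self, mul_one]
  | trans p q s _ _ ih1 ih2 =>
    obtain ⟨W1, h1⟩ := ih1
    obtain ⟨W2, h2⟩ := ih2
    exact ⟨W1.append W2, by rw [Walk.hp_append_sgn, h2, h1, mul_assoc]⟩

theorem hp_conn_of_cov (Γ : SGraph V E) {p q : V × ℤˣ} (h : Γ.hpCov p q) : Γ.hpConn p.1 q.1 := by
  rw [hpCov_iff] at h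
  induction h with
  | rel p q h =>
    obtain ⟨e, h1, h2⟩ := h
    exact Relation.EqvGen.rel _ _ ⟨e, h1⟩
  | refl p => exact Relation.EqvGen.refl _
  | symm p q _ ih => exact ih.symm
  | trans p q s _ _ ih1 ih2 => exact ih1.trans _ _ _ ih2

theorem hp_adj_symm (Γ : SGraph V E) {a b : V} (h : Γ.Adj a b) : Γ.Adj b a := by
  obtain ⟨e, h⟩ := h
  exact ⟨e, h.symm⟩

theorem hp_cov_of_conn (Γ : SGraph V E) {a b : V} (h : Γ.hpConn a b) (s : ℤˣ) :
    ∃ t, Γ.hpCov (a, s) (b, t) := by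
  rw [hpConn_iff] at h
  have : ∃ W : Γ.Walk a b, True := by
    induction h with
    | rel p q h =>
      obtain ⟨e, h1⟩ := h
      obtain ⟨W, _, hW⟩ := hp_exists_step Γ e _ _ h1
      exact ⟨W, trivial⟩
    | refl p => exact ⟨.nil _, trivial⟩
    | symm p q _ ih =>
      obtain ⟨W, _⟩ := ih
      obtain ⟨W', _, _, h⟩ := W.hp_reverse
      exact ⟨W', trivial⟩
    | trans p q s _ _ ih1 ih2 =>
      obtain ⟨W1, h1⟩ := ih1
      obtain ⟨W2, h2⟩ := ih2
      exact ⟨W1.append W2, trivial⟩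
  obtain ⟨W, _⟩ := this
  exact ⟨_, Γ.hp_cov_of_walk W s⟩

theorem hp_cov_neg (Γ : SGraph V E) {p q : V × ℤˣ} (h : Γ.hpCov p q) :
    Γ.hpCov (p.1, -p.2) (q.1, -q.2) := by
  obtain ⟨W, hW⟩ := Γ.hp_walk_of_cov h
  rw [hW, ← neg_mul]
  exact Γ.hp_cov_of_walk W _

theorem hp_balanced_iff (Γ : SGraph V E) (v : V) :
    Γ.IsBalancedComponent (Γ.comp v) ↔ ¬ Γ.hpCov (v, 1) (v, -1) := by
  constructor
  · intro hb hc
    obtain ⟨W, hW⟩ := Γ.hp_walk_of_cov hc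
    simp only [one_mul] at hW
    obtain ⟨x, P, C, _, _, hC⟩ := W.hp_neg_cycle hW.symm
    have hx : Γ.comp x = Γ.comp v :=
      (Quot.eqvGen_sound (Γ.hp_conn_of_cov (Γ.hp_cov_of_walk P 1))).symm
    have := hb x hx C hC.1
    rw [hC.2] at this
    exact absurd this (by decide)
  · intro hn x hx C _
    by_contra hs
    have hs' : C.sgn = -1 := (Int.units_eq_one_or _).resolve_left hs
    have hxv : Γ.hpConn v x := (Quot.eqvGen_exact hx).symm
    obtain ⟨t, ht⟩ := Γ.hp_cov_of_conn hxv 1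
    apply hn
    have h1 := Γ.hp_cov_of_walk C t
    rw [hs', mul_neg_one] at h1
    exact Setoid.trans' _ ht (Setoid.trans' _ h1 (Setoid.symm' _ (Γ.hp_cov_neg ht)))

theorem hp_kAll_add (Γ : SGraph V E) [Finite V] : Γ.kAll = Γ.kb + Γ.ku := by
  have : Finite Γ.Components := inferInstanceAs (Finite (Quot _))
  have := Fintype.ofFinite Γ.Components
  unfold kAll kb ku
  rw [Nat.card_eq_fintype_card, Nat.card_eq_fintype_card, Nat.card_eq_fintype_card]
  have := Fintype.card_subtype_compl (fun c => Γ.IsBalancedComponent c)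
  have h2 := Fintype.card_subtype_le (fun c => Γ.IsBalancedComponent c)
  omega

theorem hp_kD_add (Γ : SGraph V E) [Finite V] : Γ.hpkD = 2 * Γ.kb + Γ.ku := by
  have : Finite Γ.Components := inferInstanceAs (Finite (Quot _))
  have := Fintype.ofFinite Γ.Components
  have := Fintype.ofFinite (Quotient Γ.hpCov)
  rw [hp_kD_eq]
  let π : Quotient Γ.hpCov → Γ.Components :=
    Quotient.lift (fun p => Γ.comp p.1) (fun p q h => Quot.eqvGen_sound (Γ.hp_conn_of_cov h))
  have hfib : ∀ c : Γ.Components,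
      Fintype.card {q // π q = c} = if Γ.IsBalancedComponent c then 2 else 1 := by
    intro c
    induction c using Quot.inductionOn with | _ v
    change Fintype.card {q // π q = Γ.comp v} = if Γ.IsBalancedComponent (Γ.comp v) then 2 else 1
    rw [← Nat.card_eq_fintype_card]
    have hset : {q | π q = Γ.comp v} =
        {Quotient.mk Γ.hpCov (v, 1), Quotient.mk Γ.hpCov (v, -1)} := by
      ext q
      constructor
      · induction q using Quotient.inductionOn with | _ p
        obtain ⟨w, s⟩ := p
        intro hq
        have hwv : Γ.hpConn w v := Quot.eqvGen_exact hq
        obtain ⟨t, ht⟩ := Γ.hp_cov_of_conn hwv s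
        have := Quotient.sound (s := Γ.hpCov) ht
        rw [this]
        rcases Int.units_eq_one_or t with h | h <;> simp [h]
      · rintro (h | h)
        · rw [h]; rfl
        · rw [h]; rfl
    change Nat.card ↥{q | π q = Γ.comp v} = _
    rw [hset, Nat.card_coe_set_eq]
    rw [hp_balanced_iff]
    by_cases h : Γ.hpCov (v, 1) (v, -1)
    · have : Quotient.mk Γ.hpCov (v, 1) = Quotient.mk Γ.hpCov (v, -1) := Quotient.sound h
      rw [this, if_neg (not_not.2 h)]; simp
    · rw [if_pos h]
      exact Set.ncard_pair (fun h0 => h (Quotient.exact h0))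
  rw [Nat.card_congr (Equiv.sigmaFiberEquiv π).symm, Nat.card_eq_fintype_card, Fintype.card_sigma,
    Finset.sum_congr rfl (fun c _ => hfib c), Finset.sum_ite, Finset.sum_const, Finset.sum_const]
  unfold kb ku
  rw [Nat.card_eq_fintype_card, Nat.card_eq_fintype_card, Fintype.card_subtype,
    Fintype.card_subtype]
  simp only [smul_eq_mul]
  omega

theorem hp_kb_ku (Γ : SGraph V E) [Finite V] {V' E' : Type*} (Γ' : SGraph V' E') [Finite V']
    (h1 : Γ.kAll = Γ'.kAll) (h2 : Γ.hpkD = Γ'.hpkD) : Γ.kb = Γ'.kb ∧ Γ.ku = Γ'.ku := by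
  have := Γ.hp_kAll_add
  have := Γ'.hp_kAll_add
  have := Γ.hp_kD_add
  have := Γ'.hp_kD_add
  omega

end SGraph

end HelperCount

noncomputable section HelperMinor

namespace SGraph

theorem hp_eqv_add {U : Type*} (r r' : U → U → Prop) (a b : U) (h1 : ∀ x y, r x y → r' x y)
    (h2 : ∀ x y, r' x y → r x y ∨ (x = a ∧ y = b) ∨ (x = b ∧ y = a)) (h3 : r' a b) :
    Relation.EqvGen.setoid r' = hpAdd (Relation.EqvGen.setoid r) a b := by
  have hm : ∀ x y, Relation.EqvGen r x y → Relation.EqvGen r' x y :=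
    fun x y h => Relation.EqvGen.mono h1 _ _ h
  have hab : Relation.EqvGen r' a b := Relation.EqvGen.rel _ _ h3
  ext x y
  constructor
  · intro h
    change Relation.EqvGen r' x y at h
    induction h with
    | rel x y h =>
      rcases h2 x y h with h | ⟨rfl, rfl⟩ | ⟨rfl, rfl⟩
      · exact Or.inl (Relation.EqvGen.rel _ _ h)
      · exact Or.inr (Or.inl ⟨Setoid.refl' _ _, Setoid.refl' _ _⟩)
      · exact Or.inr (Or.inr ⟨Setoid.refl' _ _, Setoid.refl' _ _⟩)
    | refl x => exact Setoid.refl' _ _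
    | symm x y _ ih => exact Setoid.symm' _ ih
    | trans x y z _ _ ih1 ih2 => exact Setoid.trans' _ ih1 ih2
  · rintro (h | ⟨g1, g2⟩ | ⟨g1, g2⟩)
    · exact hm _ _ h
    · exact ((hm _ _ g1).trans _ _ _ hab).trans _ _ _ (hm _ _ g2)
    · exact ((hm _ _ g1).trans _ _ _ hab.symm).trans _ _ _ (hm _ _ g2)

variable {V E : Type*}

theorem hp_restrict_adj (Γ : SGraph V E) (A : Set E) (x y : V) :
    (Γ.restrict A).Adj x y ↔ ∃ e ∈ A, Γ.ends e = (x, y) ∨ Γ.ends e = (y, x) := by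
  constructor
  · rintro ⟨⟨e, he⟩, h⟩; exact ⟨e, he, h⟩
  · rintro ⟨e, he, h⟩; exact ⟨⟨e, he⟩, h⟩

theorem hp_restrict_dadj (Γ : SGraph V E) (A : Set E) (p q : V × ℤˣ) :
    (Γ.restrict A).hpDAdj p q ↔ ∃ e ∈ A, (Γ.ends e = (p.1, q.1) ∨ Γ.ends e = (q.1, p.1)) ∧
      q.2 = p.2 * Γ.sign e := by
  constructor
  · rintro ⟨⟨e, he⟩, h⟩; exact ⟨e, he, h⟩
  · rintro ⟨e, he, h⟩; exact ⟨⟨e, he⟩, h⟩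

theorem hp_conn_insert (Γ : SGraph V E) (A : Set E) (e : E) :
    (Γ.restrict (insert e A)).hpConn =
      hpAdd (Γ.restrict A).hpConn (Γ.ends e).1 (Γ.ends e).2 := by
  refine hp_eqv_add _ _ _ _ ?_ ?_ ?_
  · intro x y
    rw [hp_restrict_adj, hp_restrict_adj]
    rintro ⟨f, hf, h⟩
    exact ⟨f, Or.inr hf, h⟩
  · intro x y
    rw [hp_restrict_adj, hp_restrict_adj]
    rintro ⟨f, rfl | hf, h⟩
    · right
      rcases h with h | h <;> simp [h]
    · exact Or.inl ⟨f, hf, h⟩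
  · rw [hp_restrict_adj]
    exact ⟨e, Or.inl rfl, Or.inl rfl⟩

theorem hp_cov_insert (Γ : SGraph V E) (A : Set E) (e : E) :
    (Γ.restrict (insert e A)).hpCov =
      hpAdd (hpAdd (Γ.restrict A).hpCov ((Γ.ends e).1, 1) ((Γ.ends e).2, Γ.sign e))
        ((Γ.ends e).1, -1) ((Γ.ends e).2, -Γ.sign e) := by
  let r1 : V × ℤˣ → V × ℤˣ → Prop := fun x y => (Γ.restrict A).hpDAdj x y ∨
    (x = ((Γ.ends e).1, 1) ∧ y = ((Γ.ends e).2, Γ.sign e)) ∨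
    (x = ((Γ.ends e).2, Γ.sign e) ∧ y = ((Γ.ends e).1, 1))
  have h1 : Relation.EqvGen.setoid r1 =
      hpAdd (Γ.restrict A).hpCov ((Γ.ends e).1, 1) ((Γ.ends e).2, Γ.sign e) :=
    hp_eqv_add _ _ _ _ (fun x y h => Or.inl h) (fun x y h => h) (Or.inr (Or.inl ⟨rfl, rfl⟩))
  rw [← h1]
  refine hp_eqv_add _ _ _ _ ?_ ?_ ?_
  · rintro x y (h | ⟨rfl, rfl⟩ | ⟨rfl, rfl⟩)
    · rw [hp_restrict_dadj] at h ⊢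
      obtain ⟨f, hf, h⟩ := h
      exact ⟨f, Or.inr hf, h⟩
    · rw [hp_restrict_dadj]
      exact ⟨e, Or.inl rfl, Or.inl rfl, by simp⟩
    · rw [hp_restrict_dadj]
      exact ⟨e, Or.inl rfl, Or.inr rfl, by simp⟩
  · rintro ⟨x, s⟩ ⟨y, t⟩ h
    rw [hp_restrict_dadj] at h
    obtain ⟨f, hf, h, ht⟩ := h
    simp only at h ht
    rcases hf with rfl | hf
    · subst ht
      rcases h with h | h
      · rcases Int.units_eq_one_or s with rfl | rfl
        · exact Or.inl (Or.inr (Or.inl (by simp [h])))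
        · exact Or.inr (Or.inl (by simp [h]))
      · rcases Int.units_eq_one_or s with rfl | rfl <;>
          rcases Int.units_eq_one_or (Γ.sign f) with hs | hs <;> simp [h, hs, r1]
    · exact Or.inl (Or.inl ((Γ.hp_restrict_dadj A _ _).2 ⟨f, hf, h, ht⟩))
  · rw [hp_restrict_dadj]
    exact ⟨e, Or.inl rfl, Or.inl rfl, by simp⟩

theorem hpAdd_card_le {U : Type*} [Finite U] (S : Setoid U) (a b : U) :
    Nat.card (Quotient S) ≤ Nat.card (Quotient (hpAdd S a b)) + 1 := by
  by_cases h : S a b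
  · rw [hpAdd_eq S a b h]; omega
  · rw [hpAdd_card S a b h]

theorem hp_insert_bound [Finite V] (Γ : SGraph V E) (A : Set E) (e : E) :
    (Γ.restrict A).kb ≤ (Γ.restrict (insert e A)).kb + 1 := by
  have e1 := (Γ.restrict A).hp_kAll_add
  have e2 := (Γ.restrict A).hp_kD_add
  have e3 := (Γ.restrict (insert e A)).hp_kAll_add
  have e4 := (Γ.restrict (insert e A)).hp_kD_add
  rw [hp_kAll_eq] at e1 e3
  rw [hp_kD_eq] at e2 e4
  rw [hp_conn_insert] at e3
  rw [hp_cov_insert] at e4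
  set S := (Γ.restrict A).hpCov with hS
  by_cases hc : (Γ.restrict A).hpConn (Γ.ends e).1 (Γ.ends e).2
  · rw [hpAdd_eq _ _ _ hc] at e3
    obtain ⟨t, ht⟩ := (Γ.restrict A).hp_cov_of_conn hc 1
    have ht' := (Γ.restrict A).hp_cov_neg ht
    simp only at ht'
    by_cases hts : t = Γ.sign e
    · subst hts
      rw [hpAdd_eq S _ _ ht, hpAdd_eq S _ _ ht'] at e4
      omega
    · have hts' : t = -Γ.sign e := by
        rcases Int.units_eq_one_or t with h | h <;>
          rcases Int.units_eq_one_or (Γ.sign e) with h' | h' <;> simp_all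
      subst hts'
      rw [neg_neg] at ht'
      rw [hpAdd_eq (hpAdd S _ _) _ _ (Or.inr (Or.inr ⟨ht', ht⟩))] at e4
      have := hpAdd_card_le S ((Γ.ends e).1, 1) ((Γ.ends e).2, Γ.sign e)
      omega
  · have g1 := hpAdd_card _ _ _ hc
    have g2 := hpAdd_card_le S ((Γ.ends e).1, 1) ((Γ.ends e).2, Γ.sign e)
    have g3 := hpAdd_card_le (hpAdd S ((Γ.ends e).1, 1) ((Γ.ends e).2, Γ.sign e))
      ((Γ.ends e).1, -1) ((Γ.ends e).2, -Γ.sign e)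
    omega

theorem hp_card_quot_false {U : Type*} (r : U → U → Prop) (h : ∀ x y, ¬ r x y) :
    Nat.card (Quot r) = Nat.card U := by
  refine (Nat.card_congr (Equiv.ofBijective (Quot.mk r) ⟨?_, Quot.mk_surjective⟩)).symm
  intro x y hxy
  have := Quot.eqvGen_exact hxy
  induction this with
  | rel x y h0 => exact absurd h0 (h x y)
  | refl x => rfl
  | symm x y _ ih => exact (ih (Eq.symm hxy)).symm
  | trans x y z h1 h2 ih1 ih2 =>
    exact (ih1 (Quot.eqvGen_sound h1)).trans (ih2 (Quot.eqvGen_sound h2))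

theorem hp_noedges [Finite V] (Γ : SGraph V E) [IsEmpty E] :
    Γ.kAll = Nat.card V ∧ Γ.kb = Nat.card V ∧ Γ.ku = 0 := by
  have h1 : Γ.kAll = Nat.card V := hp_card_quot_false _ (by rintro x y ⟨e, _⟩; exact isEmptyElim e)
  have h2 : Γ.hpkD = Nat.card (V × ℤˣ) :=
    hp_card_quot_false _ (by rintro x y ⟨e, _⟩; exact isEmptyElim e)
  rw [Nat.card_prod] at h2
  have h3 : Nat.card ℤˣ = 2 := by rw [Nat.card_eq_fintype_card]; rfl
  rw [h3] at h2
  have e1 := Γ.hp_kAll_add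
  have e2 := Γ.hp_kD_add
  omega

theorem hp_nullity [Finite V] (Γ : SGraph V E) (A : Finset E) :
    Nat.card V ≤ A.card + (Γ.restrict (A : Set E)).kb := by
  induction A using Finset.induction_on with
  | empty =>
    have : IsEmpty ((∅ : Finset E) : Set E) := by simp
    rw [(hp_noedges (Γ.restrict ((∅ : Finset E) : Set E))).2.1]
    omega
  | insert e A he ih =>
    rw [Finset.card_insert_of_notMem he, Finset.coe_insert]
    have := Γ.hp_insert_bound (A : Set E) e
    omega

theorem hp_conn_mono (Γ : SGraph V E) {A B : Set E} (h : A ⊆ B) {x y : V}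
    (hxy : (Γ.restrict A).hpConn x y) : (Γ.restrict B).hpConn x y := by
  refine Relation.EqvGen.mono ?_ _ _ hxy
  intro a b
  rw [hp_restrict_adj, hp_restrict_adj]
  rintro ⟨f, hf, hh⟩
  exact ⟨f, h hf, hh⟩

theorem hp_k_mono [Finite V] (Γ : SGraph V E) {A B : Set E} (h : A ⊆ B) :
    (Γ.restrict B).kAll ≤ (Γ.restrict A).kAll := by
  rw [hp_kAll_eq, hp_kAll_eq]
  refine Nat.card_le_card_of_surjective
    (Quotient.map' (s₁ := (Γ.restrict A).hpConn) (s₂ := (Γ.restrict B).hpConn) id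
      (fun x y => Γ.hp_conn_mono h)) ?_
  intro q
  induction q using Quotient.inductionOn with | _ x
  exact ⟨Quotient.mk _ x, rfl⟩

theorem hp_k_univ (Γ : SGraph V E) : (Γ.restrict Set.univ).kAll = Γ.kAll := by
  have : (Γ.restrict Set.univ).Adj = Γ.Adj := by
    funext x y
    rw [hp_restrict_adj]
    simp [Adj]
  unfold kAll Components
  rw [this]

theorem hp_delete_restrict [Finite V] (Γ : SGraph V E) (e : E) (B : Set {e' : E // e' ≠ e}) :
    ((Γ.deleteEdge e).restrict B).kAll = (Γ.restrict (Subtype.val '' B)).kAll ∧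
    ((Γ.deleteEdge e).restrict B).kb = (Γ.restrict (Subtype.val '' B)).kb ∧
    ((Γ.deleteEdge e).restrict B).ku = (Γ.restrict (Subtype.val '' B)).ku := by
  have h1 : ((Γ.deleteEdge e).restrict B).Adj = (Γ.restrict (Subtype.val '' B)).Adj := by
    funext x y
    rw [hp_restrict_adj, hp_restrict_adj, Set.exists_mem_image]
    rfl
  have h2 : ((Γ.deleteEdge e).restrict B).hpDAdj = (Γ.restrict (Subtype.val '' B)).hpDAdj := by
    funext x y
    rw [hp_restrict_dadj, hp_restrict_dadj, Set.exists_mem_image]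
    rfl
  have h3 : ((Γ.deleteEdge e).restrict B).kAll = (Γ.restrict (Subtype.val '' B)).kAll := by
    unfold kAll Components
    rw [h1]
  refine ⟨h3, hp_kb_ku _ _ h3 ?_⟩
  unfold hpkD
  rw [h2]

theorem hp_contract_eqv (Γ : SGraph V E) (e : E) (S : Setoid V)
    (h : S (Γ.ends e).1 (Γ.ends e).2) {x y : V}
    (hxy : Quot.mk (Γ.contractRel e) x = Quot.mk (Γ.contractRel e) y) : S x y := by
  have := Quot.eqvGen_exact hxy
  clear hxy
  induction this with
  | rel x y h0 =>
    have h0 : (x, y) = Γ.ends e := h0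
    rw [← h0] at h
    exact h
  | refl x => exact Setoid.refl' _ _
  | symm x y _ ih => exact Setoid.symm' _ ih
  | trans x y z _ _ ih1 ih2 => exact Setoid.trans' _ ih1 ih2

theorem hp_contract_restrict [Finite V] (Γ : SGraph V E) (e : E) (hs : Γ.sign e = 1)
    (B : Set {e' : E // e' ≠ e}) :
    ((Γ.contract e).restrict B).kAll = (Γ.restrict (insert e (Subtype.val '' B))).kAll ∧
    ((Γ.contract e).restrict B).kb = (Γ.restrict (insert e (Subtype.val '' B))).kb ∧
    ((Γ.contract e).restrict B).ku = (Γ.restrict (insert e (Subtype.val '' B))).ku := by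
  have hmk : Quot.mk (Γ.contractRel e) (Γ.ends e).1 = Quot.mk (Γ.contractRel e) (Γ.ends e).2 :=
    Quot.sound rfl
  have h3 : ((Γ.contract e).restrict B).kAll =
      (Γ.restrict (insert e (Subtype.val '' B))).kAll := by
    refine hp_card_quot _ _ (Quot.mk (Γ.contractRel e)) Quot.mk_surjective ?_ ?_ ?_
    · intro x y hxy
      refine hp_contract_eqv Γ e (Γ.restrict (insert e (Subtype.val '' B))).hpConn ?_ hxy
      exact Relation.EqvGen.rel _ _ ((hp_restrict_adj _ _ _ _).2 ⟨e, Or.inl rfl, Or.inl rfl⟩)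
    · intro p q h
      rw [hp_restrict_adj] at h
      obtain ⟨f, hf, h⟩ := h
      have hf' : (f : E) ∈ insert e (Subtype.val '' B) := Or.inr ⟨f, hf, rfl⟩
      rcases h with h | h
      · have h' := Prod.ext_iff.1 h
        exact ⟨_, _, h'.1, h'.2, Relation.EqvGen.rel _ _
          ((hp_restrict_adj _ _ _ _).2 ⟨f, hf', Or.inl rfl⟩)⟩
      · have h' := Prod.ext_iff.1 h
        exact ⟨_, _, h'.2, h'.1, Relation.EqvGen.rel _ _
          ((hp_restrict_adj _ _ _ _).2 ⟨f, hf', Or.inr rfl⟩)⟩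
    · intro x y h
      rw [hp_restrict_adj] at h
      obtain ⟨f, hf, h⟩ := h
      rcases hf with rfl | ⟨f, hf, rfl⟩
      · have : Quot.mk (Γ.contractRel f) x = Quot.mk (Γ.contractRel f) y := by
          rcases h with h | h
          · rw [h] at hmk; exact hmk
          · rw [h] at hmk; exact hmk.symm
        rw [this]
        exact Relation.EqvGen.refl _
      · refine Relation.EqvGen.rel _ _ ((hp_restrict_adj _ _ _ _).2 ⟨f, hf, ?_⟩)
        rcases h with h | h
        · left; simp [contract, h]
        · right; simp [contract, h]
  refine ⟨h3, hp_kb_ku _ _ h3 ?_⟩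
  refine hp_card_quot _ _ (fun p : V × ℤˣ => (Quot.mk (Γ.contractRel e) p.1, p.2)) ?_ ?_ ?_ ?_
  · rintro ⟨q, s⟩
    obtain ⟨v, rfl⟩ := Quot.mk_surjective q
    exact ⟨(v, s), rfl⟩
  · rintro ⟨x, s⟩ ⟨y, t⟩ hxy
    obtain ⟨hxy', hst⟩ := Prod.ext_iff.1 hxy
    simp only at hxy' hst
    subst hst
    refine hp_contract_eqv Γ e
      ((Γ.restrict (insert e (Subtype.val '' B))).hpCov.comap (fun v => (v, s))) ?_ hxy'
    exact Relation.EqvGen.rel _ _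
      ((hp_restrict_dadj _ _ _ _).2 ⟨e, Or.inl rfl, Or.inl rfl, by simp [hs]⟩)
  · rintro ⟨p, s⟩ ⟨q, t⟩ h
    rw [hp_restrict_dadj] at h
    obtain ⟨f, hf, h, ht⟩ := h
    have hf' : (f : E) ∈ insert e (Subtype.val '' B) := Or.inr ⟨f, hf, rfl⟩
    simp only at h ht
    rcases h with h | h
    · have h' := Prod.ext_iff.1 h
      exact ⟨(_, s), (_, t), Prod.ext h'.1 rfl, Prod.ext h'.2 rfl, Relation.EqvGen.rel _ _
        ((hp_restrict_dadj _ _ _ _).2 ⟨f, hf', Or.inl rfl, ht⟩)⟩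
    · have h' := Prod.ext_iff.1 h
      exact ⟨(_, s), (_, t), Prod.ext h'.2 rfl, Prod.ext h'.1 rfl, Relation.EqvGen.rel _ _
        ((hp_restrict_dadj _ _ _ _).2 ⟨f, hf', Or.inr rfl, ht⟩)⟩
  · rintro ⟨x, s⟩ ⟨y, t⟩ h
    rw [hp_restrict_dadj] at h
    obtain ⟨f, hf, h, ht⟩ := h
    simp only at h ht
    rcases hf with rfl | ⟨f, hf, rfl⟩
    · have : Quot.mk (Γ.contractRel f) x = Quot.mk (Γ.contractRel f) y := by
        rcases h with h | h
        · rw [h] at hmk; exact hmk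
        · rw [h] at hmk; exact hmk.symm
      rw [hs, mul_one] at ht
      simp only [this, ht]
      exact Relation.EqvGen.refl _
    · refine Relation.EqvGen.rel _ _ ((hp_restrict_dadj _ _ _ _).2 ⟨f, hf, ?_, ht⟩)
      rcases h with h | h
      · left; simp [contract, h]
      · right; simp [contract, h]

theorem hp_insert_univ (e : E) :
    insert e (Subtype.val '' (Set.univ : Set {e' : E // e' ≠ e})) = Set.univ := by
  ext f
  by_cases h : f = e <;> simp [h]

theorem hp_contract_k [Finite V] (Γ : SGraph V E) (e : E) (hs : Γ.sign e = 1) :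
    (Γ.contract e).kAll = Γ.kAll := by
  rw [← hp_k_univ, (Γ.hp_contract_restrict e hs Set.univ).1, hp_insert_univ, hp_k_univ]

theorem hp_contract_card [Finite V] (Γ : SGraph V E) (e : E) (hl : ¬ Γ.IsLoop e) :
    Nat.card (Quot (Γ.contractRel e)) + 1 = Nat.card V := by
  have h1 : Nat.card (Quotient (hpAdd (⊥ : Setoid V) (Γ.ends e).1 (Γ.ends e).2)) + 1 =
      Nat.card (Quotient (⊥ : Setoid V)) := hpAdd_card _ _ _ hl
  have h2 : Nat.card (Quotient (⊥ : Setoid V)) = Nat.card V :=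
    (Nat.card_congr (Equiv.ofBijective (Quotient.mk (⊥ : Setoid V))
      ⟨fun x y h => Quotient.exact h, Quotient.mk_surjective⟩)).symm
  have h3 : Nat.card (Quot (Γ.contractRel e)) =
      Nat.card (Quotient (hpAdd (⊥ : Setoid V) (Γ.ends e).1 (Γ.ends e).2)) := by
    refine hp_card_quot _ _ id Function.surjective_id ?_ ?_ ?_
    · rintro x y rfl; exact Relation.EqvGen.refl _
    · intro x y h
      refine ⟨x, y, rfl, rfl, Relation.EqvGen.rel _ _ ?_⟩
      have h' := Prod.ext_iff.1 (show (x, y) = Γ.ends e from h)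
      exact Or.inr (Or.inl ⟨h'.1, h'.2.symm⟩)
    · rintro x y (h | ⟨h, h'⟩ | ⟨h, h'⟩)
      · have h : x = y := h
        subst h; exact Relation.EqvGen.refl _
      · refine Relation.EqvGen.rel _ _ ?_
        exact Prod.ext h (Eq.symm h')
      · refine (Relation.EqvGen.rel _ _ ?_).symm
        exact Prod.ext (Eq.symm h') h
  omega

theorem hp_delete_k [Finite V] (Γ : SGraph V E) (e : E) :
    (Γ.deleteEdge e).kAll = (Γ.restrict (Subtype.val '' (Set.univ : Set {e' : E // e' ≠ e}))).kAll := by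
  rw [← hp_k_univ, (Γ.hp_delete_restrict e Set.univ).1]

theorem hp_bridge_iff [Finite V] (Γ : SGraph V E) (e : E) :
    (Γ.IsBridge e ↔ ¬ (Γ.restrict (Subtype.val '' (Set.univ : Set {e' : E // e' ≠ e}))).hpConn
      (Γ.ends e).1 (Γ.ends e).2) ∧
    (Γ.IsBridge e → (Γ.deleteEdge e).kAll = Γ.kAll + 1) ∧
    (¬ Γ.IsBridge e → (Γ.deleteEdge e).kAll = Γ.kAll) := by
  unfold IsBridge
  rw [hp_delete_k, ← Γ.hp_k_univ, ← hp_insert_univ e, hp_kAll_eq, hp_kAll_eq, hp_conn_insert]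
  by_cases h : (Γ.restrict (Subtype.val '' (Set.univ : Set {e' : E // e' ≠ e}))).hpConn
      (Γ.ends e).1 (Γ.ends e).2
  · rw [hpAdd_eq _ _ _ h]
    simp [h]
  · have := hpAdd_card _ _ _ h
    rw [← this]
    simp [h]

end SGraph

end HelperMinor

noncomputable section HelperTutte

namespace SGraph

variable {V E : Type*}

theorem hp_walk_map (Γ : SGraph V E) (A : Set E) {u v : V} (W : (Γ.restrict A).Walk u v) :
    ∃ W' : Γ.Walk u v, W'.edges = W.edges.map Subtype.val ∧ W'.sgn = W.sgn := by
  induction W with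
  | nil x => exact ⟨.nil x, rfl, rfl⟩
  | cons e d p ih =>
    obtain ⟨p', h1, h2⟩ := ih
    exact ⟨Walk.cons (Γ := Γ) e.1 d p', congrArg (List.cons e.1) h1,
      congrArg (fun t => Γ.sign e.1 * t) h2⟩

theorem hp_conn_of_walk (Γ : SGraph V E) (A : Set E) {u v : V} (W : Γ.Walk u v)
    (hW : ∀ f ∈ W.edges, f ∈ A) : (Γ.restrict A).hpConn u v := by
  induction W with
  | nil x => exact Setoid.refl' _ _
  | cons e d p ih =>
    have h1 : (Γ.restrict A).hpConn (Γ.endpt e d) (Γ.endpt e (!d)) := by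
      refine Relation.EqvGen.rel _ _ ((hp_restrict_adj _ _ _ _).2
        ⟨e, hW e (by simp [Walk.edges]), ?_⟩)
      cases d <;> simp [endpt]
    exact Setoid.trans' _ h1 (ih (fun f hf => hW f (by simp [Walk.edges, hf])))

theorem hp_bridge_sep [Finite V] (Γ : SGraph V E) (e : E) (hb : Γ.IsBridge e)
    (B : Set {e' : E // e' ≠ e}) :
    ¬ (Γ.restrict (Subtype.val '' B)).hpConn (Γ.ends e).1 (Γ.ends e).2 := fun h =>
  (Γ.hp_bridge_iff e).1.1 hb (Γ.hp_conn_mono (Set.image_mono (Set.subset_univ B)) h)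

theorem hp_bridge_ins [Finite V] (Γ : SGraph V E) (e : E) (hb : Γ.IsBridge e)
    (B : Set {e' : E // e' ≠ e}) :
    (Γ.restrict (insert e (Subtype.val '' B))).kAll + 1 = (Γ.restrict (Subtype.val '' B)).kAll := by
  rw [hp_kAll_eq, hp_kAll_eq, hp_conn_insert, hpAdd_card _ _ _ (Γ.hp_bridge_sep e hb B)]

theorem hp_bridge_not_circuit [Finite V] (Γ : SGraph V E) (e : E) (hs : Γ.sign e = 1)
    (hb : Γ.IsBridge e) (hc : ¬ Γ.IsCircuitPathEdge e) (B : Set {e' : E // e' ≠ e}) :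
    (Γ.restrict (insert e (Subtype.val '' B))).kb + 1 = (Γ.restrict (Subtype.val '' B)).kb ∧
    (Γ.restrict (insert e (Subtype.val '' B))).ku = (Γ.restrict (Subtype.val '' B)).ku := by
  have hk := Γ.hp_bridge_ins e hb B
  have hsep := Γ.hp_bridge_sep e hb B
  have hD : (Γ.restrict (insert e (Subtype.val '' B))).hpkD + 2 =
      (Γ.restrict (Subtype.val '' B)).hpkD := by
    rw [hp_kD_eq, hp_kD_eq, hp_cov_insert, hs]
    set S := (Γ.restrict (Subtype.val '' B)).hpCov with hS
    have g1 : ¬ S ((Γ.ends e).1, 1) ((Γ.ends e).2, 1) := fun h =>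
      hsep ((Γ.restrict (Subtype.val '' B)).hp_conn_of_cov h)
    have g2 : ¬ hpAdd S ((Γ.ends e).1, 1) ((Γ.ends e).2, 1) ((Γ.ends e).1, -1)
        ((Γ.ends e).2, -1) := by
      rintro (h | ⟨h1, h2⟩ | ⟨h1, h2⟩)
      · exact hsep ((Γ.restrict (Subtype.val '' B)).hp_conn_of_cov h)
      · apply hc
        obtain ⟨W₁, w1⟩ := (Γ.restrict (Subtype.val '' B)).hp_walk_of_cov (Setoid.symm' _ h1)
        obtain ⟨W₂, w2⟩ := (Γ.restrict (Subtype.val '' B)).hp_walk_of_cov h2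
        simp only [one_mul] at w1 w2
        obtain ⟨W₁', a1, a2⟩ := Γ.hp_walk_map _ W₁
        obtain ⟨W₂', b1, b2⟩ := Γ.hp_walk_map _ W₂
        have hav : ∀ l : List (Subtype.val '' B : Set E), e ∉ l.map Subtype.val := by
          intro l hl
          obtain ⟨⟨f, ⟨g, _, hg⟩⟩, _, hf⟩ := List.mem_map.1 hl
          exact g.2 (hg.trans hf)
        refine Γ.hp_handcuff e ?_ W₁' (a2.trans w1.symm) (fun h => hav W₁.edges (a1 ▸ h))
          W₂' (b2.trans w2.symm) (fun h => hav W₂.edges (b1 ▸ h))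
        intro W
        by_contra hW
        refine (Γ.hp_bridge_iff e).1.1 hb (Γ.hp_conn_of_walk _ W ?_)
        intro f hf
        exact ⟨⟨f, fun h => hW (h ▸ hf)⟩, trivial, rfl⟩
      · exact hsep ((Γ.restrict (Subtype.val '' B)).hp_conn_of_cov (Setoid.symm' _
          (Setoid.symm' _ h1)))
    rw [← hpAdd_card S _ _ g1, ← hpAdd_card _ _ _ g2]
  have e1 := (Γ.restrict (Subtype.val '' B)).hp_kAll_add
  have e2 := (Γ.restrict (Subtype.val '' B)).hp_kD_add
  have e3 := (Γ.restrict (insert e (Subtype.val '' B))).hp_kAll_add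
  have e4 := (Γ.restrict (insert e (Subtype.val '' B))).hp_kD_add
  omega

/-- The summand of the signed Tutte polynomial. -/
def hpT (Γ : SGraph V E) (x y z : ℚ) (A : Set E) (n : ℕ) : ℚ :=
  (x - 1) ^ ((Γ.restrict A).kAll - Γ.kAll) *
    (y - 1) ^ ((n + (Γ.restrict A).kb) - Nat.card V) * (z - 1) ^ (Γ.restrict A).ku

theorem hp_tutte_sum [Fintype E] (Γ : SGraph V E) (x y z : ℚ) :
    Γ.signedTutte x y z = ∑ A : Finset E, Γ.hpT x y z (A : Set E) A.card := by
  unfold signedTutte hpT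
  rw [finsum_eq_sum_of_fintype]

theorem hp_sum_split [Fintype E] (e : E) (F : Finset E → ℚ) :
    ∑ A : Finset E, F A = ∑ B : Finset {e' : E // e' ≠ e},
      (F (B.map (Function.Embedding.subtype _)) +
        F (insert e (B.map (Function.Embedding.subtype _)))) := by
  have h1 : (Finset.univ : Finset E) = insert e (Finset.univ.filter (fun f => f ≠ e)) := by
    ext f; by_cases h : f = e <;> simp [h]
  have h2 : ∀ G : Finset E → ℚ, ∑ A ∈ (Finset.univ.filter (fun f => f ≠ e)).powerset, G A =
      ∑ B : Finset {e' : E // e' ≠ e}, G (B.map (Function.Embedding.subtype _)) := by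
    intro G
    symm
    refine Finset.sum_bij (fun B _ => B.map (Function.Embedding.subtype _)) ?_ ?_ ?_ ?_
    · intro B _
      rw [Finset.mem_powerset]
      intro f hf
      obtain ⟨g, _, rfl⟩ := Finset.mem_map.1 hf
      simpa using g.2
    · intro B _ B' _ h
      exact Finset.map_injective _ h
    · intro A hA
      refine ⟨A.subtype (fun f => f ≠ e), Finset.mem_univ _, ?_⟩
      rw [Finset.subtype_map, Finset.filter_true_of_mem]
      intro f hf
      simpa using Finset.mem_powerset.1 hA hf
    · intro B _; rfl
  rw [← Finset.powerset_univ, h1, Finset.sum_powerset_insert (by simp), h2, h2,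
    ← Finset.sum_add_distrib]

theorem hp_tutte_split [Fintype E] (Γ : SGraph V E) (e : E) (x y z : ℚ) :
    Γ.signedTutte x y z = ∑ B : Finset {e' : E // e' ≠ e},
      (Γ.hpT x y z (Subtype.val '' (B : Set {e' : E // e' ≠ e})) B.card +
        Γ.hpT x y z (insert e (Subtype.val '' (B : Set {e' : E // e' ≠ e}))) (B.card + 1)) := by
  rw [hp_tutte_sum, hp_sum_split e]
  refine Finset.sum_congr rfl (fun B _ => ?_)
  rw [Finset.card_insert_of_notMem (by simp), Finset.card_map, Finset.coe_insert, Finset.coe_map]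
  rfl

theorem hpT_contract [Finite V] (Γ : SGraph V E) (e : E) (hs : Γ.sign e = 1) (hl : ¬ Γ.IsLoop e)
    (x y z : ℚ) (B : Set {e' : E // e' ≠ e}) (n : ℕ) :
    (Γ.contract e).hpT x y z B n = Γ.hpT x y z (insert e (Subtype.val '' B)) (n + 1) := by
  unfold hpT
  obtain ⟨h1, h2, h3⟩ := Γ.hp_contract_restrict e hs B
  have h4 := Γ.hp_contract_card e hl
  rw [h1, h2, h3, Γ.hp_contract_k e hs, ← h4]
  congr 3
  omega

theorem hpT_delete [Finite V] (Γ : SGraph V E) (e : E) (hb : ¬ Γ.IsBridge e)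
    (x y z : ℚ) (B : Set {e' : E // e' ≠ e}) (n : ℕ) :
    (Γ.deleteEdge e).hpT x y z B n = Γ.hpT x y z (Subtype.val '' B) n := by
  unfold hpT
  obtain ⟨h1, h2, h3⟩ := Γ.hp_delete_restrict e B
  rw [h1, h2, h3, (Γ.hp_bridge_iff e).2.2 hb]

theorem hp_le_restrict [Finite V] (Γ : SGraph V E) (A : Set E) :
    Γ.kAll ≤ (Γ.restrict A).kAll := by
  rw [← Γ.hp_k_univ]
  exact Γ.hp_k_mono (Set.subset_univ A)

theorem hpT_delete_bridge [Finite V] (Γ : SGraph V E) (e : E) (hb : Γ.IsBridge e)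
    (x y z : ℚ) (B : Set {e' : E // e' ≠ e}) (n : ℕ) :
    (x - 1) * (Γ.deleteEdge e).hpT x y z B n = Γ.hpT x y z (Subtype.val '' B) n := by
  unfold hpT
  obtain ⟨h1, h2, h3⟩ := Γ.hp_delete_restrict e B
  have h4 := (Γ.hp_bridge_iff e).2.1 hb
  have h5 := (Γ.deleteEdge e).hp_le_restrict B
  rw [h1, h4] at h5
  rw [h1, h2, h3, h4, ← mul_assoc, ← mul_assoc, ← pow_succ']
  congr 3
  omega

theorem hpT_not_circuit [Finite V] (Γ : SGraph V E) (e : E) (hs : Γ.sign e = 1)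
    (hb : Γ.IsBridge e) (hc : ¬ Γ.IsCircuitPathEdge e)
    (x y z : ℚ) (B : Set {e' : E // e' ≠ e}) (n : ℕ) :
    Γ.hpT x y z (Subtype.val '' B) n =
      (x - 1) * Γ.hpT x y z (insert e (Subtype.val '' B)) (n + 1) := by
  unfold hpT
  obtain ⟨h1, h2⟩ := Γ.hp_bridge_not_circuit e hs hb hc B
  have h3 := Γ.hp_bridge_ins e hb B
  have h4 := Γ.hp_le_restrict (insert e (Subtype.val '' B))
  rw [← h1, ← h2, ← h3, ← mul_assoc, ← mul_assoc, ← pow_succ']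
  congr 3 <;> omega

theorem hpT_loop [Finite V] (Γ : SGraph V E) (e : E) (hs : Γ.sign e = 1)
    (hl : Γ.IsLoop e) (x y z : ℚ) (A : Set E) (n : ℕ)
    (hn : Nat.card V ≤ n + (Γ.restrict A).kb) :
    Γ.hpT x y z (insert e A) (n + 1) = (y - 1) * Γ.hpT x y z A n := by
  have hl' : (Γ.ends e).1 = (Γ.ends e).2 := hl
  have h1 : (Γ.restrict (insert e A)).kAll = (Γ.restrict A).kAll := by
    rw [hp_kAll_eq, hp_kAll_eq, hp_conn_insert, hpAdd_eq]
    rw [hl']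
  have h2 : (Γ.restrict (insert e A)).hpkD = (Γ.restrict A).hpkD := by
    rw [hp_kD_eq, hp_kD_eq, hp_cov_insert, hl', hs, hpAdd_eq _ _ _ (Setoid.refl' _ _),
      hpAdd_eq _ _ _ (Setoid.refl' _ _)]
  obtain ⟨h3, h4⟩ := hp_kb_ku _ _ h1 h2
  unfold hpT
  rw [h1, h3, h4, show n + 1 + (Γ.restrict A).kb - Nat.card V =
    (n + (Γ.restrict A).kb - Nat.card V) + 1 by omega, pow_succ]
  ring

theorem hp_bridge_not_loop [Finite V] (Γ : SGraph V E) (e : E) (hb : Γ.IsBridge e) :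
    ¬ Γ.IsLoop e := by
  intro hl
  apply (Γ.hp_bridge_iff e).1.1 hb
  have hl' : (Γ.ends e).1 = (Γ.ends e).2 := hl
  rw [hl']

theorem hp_loops_term [Finite V] (Γ : SGraph V E) (hV : Nat.card V = 1)
    (h : ∀ e : E, Γ.IsLoop e ∧ Γ.sign e = -1) (x y z : ℚ) (A : Finset E) :
    Γ.hpT x y z (A : Set E) A.card =
      if A = ∅ then 1 else (z - 1) * (y - 1) ^ (A.card - 1) := by
  obtain ⟨hsub, ⟨v⟩⟩ := Nat.card_eq_one_iff_unique.1 hV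
  have hk : ∀ {E' : Type _} (Γ' : SGraph V E'), Γ'.kAll = 1 := by
    intro E' Γ'
    refine Nat.card_eq_one_iff_unique.2 ⟨?_, ⟨Quot.mk _ v⟩⟩
    constructor
    intro p q
    induction p using Quot.inductionOn with | _ a
    induction q using Quot.inductionOn with | _ b
    rw [Subsingleton.elim a b]
  have e0 := (Γ.restrict (A : Set E)).hp_kAll_add
  have e1 := (Γ.restrict (A : Set E)).hp_kD_add
  rw [hk] at e0
  unfold hpT
  rw [hk, show Γ.kAll = 1 from hk (E' := E) Γ, hV]
  split_ifs with hA
  · subst hA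
    have : IsEmpty ((∅ : Finset E) : Set E) := by simp
    obtain ⟨-, h2, h3⟩ := hp_noedges (Γ.restrict ((∅ : Finset E) : Set E))
    rw [h2, h3, hV]
    simp
  · obtain ⟨e, he⟩ := Finset.nonempty_iff_ne_empty.2 hA
    have hD : (Γ.restrict (A : Set E)).hpkD = 1 := by
      refine Nat.card_eq_one_iff_unique.2 ⟨?_, ⟨Quot.mk _ (v, 1)⟩⟩
      constructor
      have hst : ∀ a b : V, ∀ s : ℤˣ, Quot.mk (Γ.restrict (A : Set E)).hpDAdj (a, s) =
          Quot.mk _ (b, -s) := by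
        intro a b s
        refine Quot.sound ((hp_restrict_dadj _ _ _ _).2 ⟨e, he, Or.inl ?_, ?_⟩)
        · exact Prod.ext (Subsingleton.elim _ _) (Subsingleton.elim _ _)
        · simp [(h e).2]
      intro p q
      induction p using Quot.inductionOn with | _ a
      induction q using Quot.inductionOn with | _ b
      obtain ⟨a, s⟩ := a
      obtain ⟨b, t⟩ := b
      by_cases h0 : t = s
      · rw [h0, Subsingleton.elim a b]
      · have : t = -s := by
          rcases Int.units_eq_one_or t with h | h <;>
            rcases Int.units_eq_one_or s with h' | h' <;> simp_all
        rw [this]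
        exact hst a b s
    have hb : (Γ.restrict (A : Set E)).kb = 0 := by omega
    have hu : (Γ.restrict (A : Set E)).ku = 1 := by omega
    rw [hb, hu]
    simp [mul_comm]

theorem hp_loops_sum (s : Finset E) (y z : ℚ) :
    ∑ A ∈ s.powerset, (if A = ∅ then (1 : ℚ) else (z - 1) * (y - 1) ^ (A.card - 1)) =
      1 + (z - 1) * ∑ i ∈ Finset.range s.card, y ^ i := by
  induction s using Finset.induction_on with
  | empty => simp
  | insert e s he ih =>
    rw [Finset.sum_powerset_insert he, ih, Finset.card_insert_of_notMem he, Finset.sum_range_succ]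
    have h1 : ∀ A ∈ s.powerset, (if insert e A = ∅ then (1 : ℚ) else
        (z - 1) * (y - 1) ^ ((insert e A).card - 1)) = (z - 1) * ((y - 1) ^ A.card *
          1 ^ (s.card - A.card)) := by
      intro A hA
      rw [if_neg (Finset.insert_ne_empty _ _),
        Finset.card_insert_of_notMem (fun h => he (Finset.mem_powerset.1 hA h))]
      simp
    rw [Finset.sum_congr rfl h1, ← Finset.mul_sum, Finset.sum_pow_mul_eq_add_pow]
    rw [sub_add_cancel]
    ring

end SGraph

end HelperTutte

section Statement

open SGraph

/-- Theorem 4.1 (deletion–contraction for the signed Tutte polynomial). -/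
theorem signedTutte_deletion_contraction :
    (∀ (V E : Type) [Finite V] [Finite E] (Γ : SGraph V E) (e : E) (x y z : ℚ),
      Γ.sign e = 1 →
        ((¬ Γ.IsLoop e ∧ ¬ Γ.IsBridge e →
            Γ.signedTutte x y z =
              (Γ.contract e).signedTutte x y z + (Γ.deleteEdge e).signedTutte x y z) ∧
          (Γ.IsBridge e ∧ Γ.IsCircuitPathEdge e →
            Γ.signedTutte x y z =
              (Γ.contract e).signedTutte x y z +
                (x - 1) * (Γ.deleteEdge e).signedTutte x y z) ∧
          (Γ.IsBridge e ∧ ¬ Γ.IsCircuitPathEdge e →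
            Γ.signedTutte x y z = x * (Γ.contract e).signedTutte x y z) ∧
          (Γ.IsLoop e →
            Γ.signedTutte x y z = y * (Γ.deleteEdge e).signedTutte x y z))) ∧
    (∀ (V E : Type) [Finite V] [Finite E] (Γ : SGraph V E) (ℓ : ℕ) (x y z : ℚ),
      1 ≤ ℓ → Nat.card V = 1 → Nat.card E = ℓ →
        (∀ e : E, Γ.IsLoop e ∧ Γ.sign e = -1) →
          Γ.signedTutte x y z = 1 + (z - 1) * ∑ i ∈ Finset.range ℓ, y ^ i) ∧
    (∀ (V E : Type) [Finite V] [Finite E] (Γ : SGraph V E) (x y z : ℚ),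
      IsEmpty E → Γ.signedTutte x y z = 1) := by
  refine ⟨?_, ?_, ?_⟩
  · intro V E _ _ Γ e x y z hs
    have := Fintype.ofFinite E
    refine ⟨?_, ?_, ?_, ?_⟩
    · rintro ⟨hl, hb⟩
      rw [Γ.hp_tutte_split e, hp_tutte_sum, hp_tutte_sum, ← Finset.sum_add_distrib]
      refine Finset.sum_congr rfl (fun B _ => ?_)
      rw [Γ.hpT_contract e hs hl, Γ.hpT_delete e hb, add_comm]
    · rintro ⟨hb, -⟩
      rw [Γ.hp_tutte_split e, hp_tutte_sum, hp_tutte_sum, Finset.mul_sum,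
        ← Finset.sum_add_distrib]
      refine Finset.sum_congr rfl (fun B _ => ?_)
      rw [Γ.hpT_contract e hs (Γ.hp_bridge_not_loop e hb), Γ.hpT_delete_bridge e hb, add_comm]
    · rintro ⟨hb, hc⟩
      rw [Γ.hp_tutte_split e, hp_tutte_sum, Finset.mul_sum]
      refine Finset.sum_congr rfl (fun B _ => ?_)
      rw [Γ.hpT_contract e hs (Γ.hp_bridge_not_loop e hb), Γ.hpT_not_circuit e hs hb hc]
      ring
    · intro hl
      rw [Γ.hp_tutte_split e, hp_tutte_sum, Finset.mul_sum]
      refine Finset.sum_congr rfl (fun B _ => ?_)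
      have hn := (Γ.deleteEdge e).hp_nullity B
      rw [(Γ.hp_delete_restrict e _).2.1] at hn
      rw [Γ.hpT_delete e (fun hb => Γ.hp_bridge_not_loop e hb hl), Γ.hpT_loop e hs hl x y z _ _ hn]
      ring
  · intro V E _ _ Γ ℓ x y z _ hV hE h
    have := Fintype.ofFinite E
    rw [hp_tutte_sum, Finset.sum_congr rfl (fun A _ => Γ.hp_loops_term hV h x y z A),
      ← Finset.powerset_univ, hp_loops_sum, Finset.card_univ, ← Nat.card_eq_fintype_card, hE]
  · intro V E _ _ Γ x y z hE
    have := Fintype.ofFinite E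
    rw [hp_tutte_sum, Fintype.sum_unique]
    have h1 := Γ.hp_noedges
    have h2 : IsEmpty ((default : Finset E) : Set E) := ⟨fun f => isEmptyElim f.1⟩
    have h3 := (Γ.restrict ((default : Finset E) : Set E)).hp_noedges
    have h4 : (default : Finset E).card = 0 := rfl
    unfold hpT
    rw [h1.1, h3.1, h3.2.1, h3.2.2, h4]
    simp

end Statement
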